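/- arXiv:2103.05734 — 6 statements merged into one kernel-verified Lean document; each statement's English description precedes it below -/
import Mathlib

section
/- Let ρ, φ be d×d density matrices with supp ρ ⊆ supp φ. Then lim_{λ→0⁺} ((1−λ)/λ) · S(φ ‖ (1−λ)φ + λρ) = 0, where for each λ ∈ (0,1) the relative entropy S(φ ‖ (1−λ)φ + λρ) is finite because supp φ ⊆ supp((1−λ)φ + λρ). -/
open Matrix
open scoped ComplexOrder

/-- Spectral logarithm of a Hermitian matrix (eigenvalue 0 ↦ 0 via `Real.log 0 = 0`). -/
noncomputable def matLog {d : ℕ} (A : Matrix (Fin d) (Fin d) ℂ) : Matrix (Fin d) (Fin d) ℂ :=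
  if hA : A.IsHermitian then
    (hA.eigenvectorUnitary : Matrix (Fin d) (Fin d) ℂ) *
      Matrix.diagonal (fun i => (Real.log (hA.eigenvalues i) : ℂ)) *
      (star (hA.eigenvectorUnitary : Matrix (Fin d) (Fin d) ℂ))
  else 0

/-- Von Neumann entropy `S(ρ) = -tr(ρ log ρ)`. -/
noncomputable def vN {d : ℕ} (ρ : Matrix (Fin d) (Fin d) ℂ) : ℝ :=
  -(ρ * matLog ρ).trace.re

/-- Quantum relative entropy `S(ρ‖φ) = tr(ρ (log ρ - log φ))`. -/
noncomputable def qRelEnt {d : ℕ} (ρ φ : Matrix (Fin d) (Fin d) ℂ) : ℝ :=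
  ((ρ * (matLog ρ - matLog φ)).trace).re

/-- A density matrix: positive semidefinite with unit trace. -/
def IsDensity {d : ℕ} (ρ : Matrix (Fin d) (Fin d) ℂ) : Prop :=
  ρ.PosSemidef ∧ ρ.trace = 1

/-- Support (= range) inclusion of matrices. -/
def SuppLE {d : ℕ} (ρ φ : Matrix (Fin d) (Fin d) ℂ) : Prop :=
  LinearMap.range ρ.mulVecLin ≤ LinearMap.range φ.mulVecLin

/-- A positive trace-preserving linear map. -/
def IsPTP {d d' : ℕ} (Φ : Matrix (Fin d) (Fin d) ℂ →ₗ[ℂ] Matrix (Fin d') (Fin d') ℂ) : Prop :=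
  (∀ X, X.PosSemidef → (Φ X).PosSemidef) ∧ (∀ X, (Φ X).trace = X.trace)

/-- The EP-type function `Σ(ρ) = S(Φ(ρ)) - S(ρ) + Q(ρ)`. -/
noncomputable def EPfun {d d' : ℕ} (Φ : Matrix (Fin d) (Fin d) ℂ →ₗ[ℂ] Matrix (Fin d') (Fin d') ℂ)
    (Q : Matrix (Fin d) (Fin d) ℂ →ₗ[ℝ] ℝ) (ρ : Matrix (Fin d) (Fin d) ℂ) : ℝ :=
  vN (Φ ρ) - vN ρ + Q ρ

open Finset in
theorem tr_formula {d : ℕ} (U V : Matrix (Fin d) (Fin d) ℂ) (f g : Fin d → ℝ) :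
    ((U * diagonal (fun i => (f i : ℂ)) * star U) * (V * diagonal (fun i => (g i : ℂ)) * star V)).trace.re
      = ∑ i, ∑ j, Complex.normSq ((star U * V) i j) * (f i * g j) := by
  have h : ((U * diagonal (fun i => (f i : ℂ)) * star U) * (V * diagonal (fun i => (g i : ℂ)) * star V)).trace
     = (diagonal (fun i => (f i : ℂ)) * (star U * V) * (diagonal (fun i => (g i : ℂ)) * star (star U * V))).trace := by
    rw [star_mul, star_star]
    simp only [Matrix.mul_assoc]
    rw [Matrix.trace_mul_comm]
    simp only [Matrix.mul_assoc]
  rw [h]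
  generalize star U * V = W
  simp only [Matrix.trace, Matrix.diag, Matrix.mul_apply (M := diagonal _ * W), Complex.re_sum]
  refine sum_congr rfl fun i _ => sum_congr rfl fun j _ => ?_
  rw [Matrix.diagonal_mul, Matrix.diagonal_mul, Matrix.star_apply]
  simp [Complex.normSq_apply]
  ring

theorem scal_lower {p q : ℝ} (hp : 0 ≤ p) (hq : 0 ≤ q) (h : p = 0 ↔ q = 0) :
    p - q ≤ p * (Real.log p - Real.log q) := by
  by_cases h0 : p = 0
  · have := h.1 h0; subst h0; subst this; simp
  have hp' : 0 < p := lt_of_le_of_ne hp (Ne.symm h0)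
  have hq' : 0 < q := lt_of_le_of_ne hq (fun e => h0 (h.2 e.symm))
  have := Real.log_le_sub_one_of_pos (div_pos hq' hp')
  rw [Real.log_div hq'.ne' hp'.ne'] at this
  have h2 : p * (q / p - 1) = q - p := by field_simp
  nlinarith [mul_le_mul_of_nonneg_left this hp]

theorem scal_upper {p q c : ℝ} (hc : 0 < c) (hp : 0 ≤ p) (hq : 0 ≤ q) (h : p = 0 ↔ q = 0)
    (hcq : q ≠ 0 → c ≤ q) :
    p * (Real.log p - Real.log q) ≤ (p - q) + (p - q) ^ 2 / c := by
  by_cases h0 : p = 0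
  · have := h.1 h0; subst h0; subst this; simp
  have hp' : 0 < p := lt_of_le_of_ne hp (Ne.symm h0)
  have hq' : 0 < q := lt_of_le_of_ne hq (fun e => h0 (h.2 e.symm))
  have := Real.log_le_sub_one_of_pos (div_pos hp' hq')
  rw [Real.log_div hp'.ne' hq'.ne'] at this
  have h2 : p * (p / q - 1) = (p - q) + (p - q)^2 / q := by field_simp; ring
  have h3 : (p - q)^2 / q ≤ (p - q)^2 / c :=
    div_le_div_of_nonneg_left (sq_nonneg _) hc (hcq hq'.ne')
  nlinarith [mul_le_mul_of_nonneg_left this hp]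

theorem ker_rho {d : ℕ} {ρ φ : Matrix (Fin d) (Fin d) ℂ} (hρ : ρ.PosSemidef) (hφ : φ.PosSemidef)
    (hs : SuppLE ρ φ) {v : Fin d → ℂ} (hv : φ *ᵥ v = 0) : ρ *ᵥ v = 0 := by
  rw [← hρ.dotProduct_mulVec_zero_iff]
  obtain ⟨u, hu⟩ := hs ⟨v, rfl⟩
  simp only [Matrix.mulVecLin_apply] at hu
  rw [← hu, Matrix.dotProduct_mulVec]
  have : star v ᵥ* φ = star (φ *ᵥ v) := by rw [Matrix.star_mulVec, hφ.1.eq]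
  rw [this, hv]; simp

theorem ker_sigma {d : ℕ} {ρ φ : Matrix (Fin d) (Fin d) ℂ} (hρ : ρ.PosSemidef) (hφ : φ.PosSemidef)
    {l : ℝ} (hl : l ∈ Set.Ioo (0:ℝ) 1) {v : Fin d → ℂ}
    (hv : ((1 - (l : ℂ)) • φ + (l : ℂ) • ρ) *ᵥ v = 0) : φ *ᵥ v = 0 := by
  rw [← hφ.dotProduct_mulVec_zero_iff]
  have h1 := hφ.dotProduct_mulVec_nonneg v
  have h2 := hρ.dotProduct_mulVec_nonneg v
  have h := congrArg (fun w => star v ⬝ᵥ w) hv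
  simp only [Matrix.add_mulVec, Matrix.smul_mulVec, dotProduct_add, dotProduct_smul, dotProduct_zero, smul_eq_mul] at h
  generalize star v ⬝ᵥ φ *ᵥ v = x at *
  generalize star v ⬝ᵥ ρ *ᵥ v = y at *
  rw [Complex.nonneg_iff] at h1 h2
  have hre := congrArg Complex.re h
  simp at hre
  apply Complex.ext
  · simp
    have := hl.1; have := hl.2
    nlinarith [mul_nonneg (sub_pos.2 hl.2).le h1.1, mul_nonneg hl.1.le h2.1]
  · simp [← h1.2]

theorem sigma_psd {d : ℕ} {ρ φ : Matrix (Fin d) (Fin d) ℂ} (hρ : ρ.PosSemidef) (hφ : φ.PosSemidef)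
    {l : ℝ} (hl : l ∈ Set.Ioo (0:ℝ) 1) : ((1 - (l : ℂ)) • φ + (l : ℂ) • ρ).PosSemidef := by
  refine (hφ.smul ?_).add (hρ.smul ?_)
  · have : (0:ℂ) ≤ ((1 - l : ℝ) : ℂ) := by exact_mod_cast (sub_pos.2 hl.2).le
    simpa using this
  · exact_mod_cast hl.1.le

theorem supp_part {d : ℕ} {ρ φ : Matrix (Fin d) (Fin d) ℂ} (hρ : ρ.PosSemidef) (hφ : φ.PosSemidef)
    (hs : SuppLE ρ φ) {l : ℝ} (hl : l ∈ Set.Ioo (0:ℝ) 1) :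
    SuppLE φ ((1 - (l : ℂ)) • φ + (l : ℂ) • ρ) := by
  set σ := (1 - (l : ℂ)) • φ + (l : ℂ) • ρ with hσ
  have hle : LinearMap.range σ.mulVecLin ≤ LinearMap.range φ.mulVecLin := by
    rintro _ ⟨v, rfl⟩
    rw [Matrix.mulVecLin_apply, hσ, Matrix.add_mulVec, Matrix.smul_mulVec, Matrix.smul_mulVec]
    exact Submodule.add_mem _ (Submodule.smul_mem _ _ ⟨v, rfl⟩) (Submodule.smul_mem _ _ (hs ⟨v, rfl⟩))
  have hk : LinearMap.ker σ.mulVecLin = LinearMap.ker φ.mulVecLin := by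
    ext v
    simp only [LinearMap.mem_ker, Matrix.mulVecLin_apply]
    constructor
    · exact fun h => ker_sigma hρ hφ hl h
    · intro h
      rw [hσ, Matrix.add_mulVec, Matrix.smul_mulVec, Matrix.smul_mulVec, h, ker_rho hρ hφ hs h]; simp
  have h1 := LinearMap.finrank_range_add_finrank_ker σ.mulVecLin
  have h2 := LinearMap.finrank_range_add_finrank_ker φ.mulVecLin
  rw [hk] at h1
  exact (Submodule.eq_of_le_of_finrank_eq hle (by omega)).ge

theorem spec_form {d : ℕ} {A : Matrix (Fin d) (Fin d) ℂ} (hA : A.IsHermitian) :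
    A = (hA.eigenvectorUnitary : Matrix (Fin d) (Fin d) ℂ) *
      Matrix.diagonal (fun i => (hA.eigenvalues i : ℂ)) *
      (star (hA.eigenvectorUnitary : Matrix (Fin d) (Fin d) ℂ)) := by
  have := hA.spectral_theorem
  rw [Unitary.conjStarAlgAut_apply] at this
  exact this

/-- overlap vanishing -/
theorem overlap {d : ℕ} {A U V B : Matrix (Fin d) (Fin d) ℂ} {p q : Fin d → ℝ}
    (hA : A.IsHermitian) (hB : B.IsHermitian)
    (hU : A * U = U * diagonal (fun i => (p i : ℂ))) (hV : B * V = V * diagonal (fun i => (q i : ℂ)))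
    (hk : ∀ v, A *ᵥ v = 0 → B *ᵥ v = 0) {i j : Fin d} (hp : p i = 0) :
    q j = 0 ∨ (star U * V) i j = 0 := by
  have hAu : A *ᵥ U.col i = 0 := by
    have := congrArg (fun M => M.col i) hU
    ext k
    have := congrFun this k
    simp [Matrix.mul_diagonal, hp] at this
    exact this
  have hBu := hk _ hAu
  have h1 : (star U * B) i = 0 := by
    have : star U * B = star (B * U) := by
      rw [star_mul, Matrix.star_eq_conjTranspose B, hB.eq]
    rw [this]
    ext k
    have := congrFun hBu k
    rw [Matrix.star_apply]
    change (B * U) k i = 0 at this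
    rw [this]; simp
  have h2 : (star U * V * diagonal (fun i => (q i : ℂ))) i j = 0 := by
    rw [Matrix.mul_assoc, ← hV, ← Matrix.mul_assoc, Matrix.mul_apply]
    refine Finset.sum_eq_zero fun k _ => ?_
    rw [h1]; simp
  rw [Matrix.mul_diagonal] at h2
  rcases mul_eq_zero.1 h2 with h | h
  · exact Or.inr h
  · left; exact_mod_cast h

theorem uconj_mul {d : ℕ} {U : Matrix (Fin d) (Fin d) ℂ} (hU : star U * U = 1) (f g : Fin d → ℝ) :
    (U * diagonal (fun i => (f i : ℂ)) * star U) * (U * diagonal (fun i => (g i : ℂ)) * star U)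
      = U * diagonal (fun i => ((f i * g i : ℝ) : ℂ)) * star U := by
  calc _ = U * diagonal (fun i => (f i : ℂ)) * (star U * U) * diagonal (fun i => (g i : ℂ)) * star U := by
        simp only [Matrix.mul_assoc]
    _ = _ := by
        rw [hU, Matrix.mul_one, Matrix.mul_assoc U, Matrix.diagonal_mul_diagonal]
        simp

theorem uconj_one {d : ℕ} {U : Matrix (Fin d) (Fin d) ℂ} (hU : U * star U = 1) :
    U * diagonal (fun _ => ((1 : ℝ) : ℂ)) * star U = 1 := by
  simp [hU]

theorem ent_bound {d : ℕ} {φ σ : Matrix (Fin d) (Fin d) ℂ} (hφ : φ.PosSemidef) (hσ : σ.PosSemidef)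
    (htr : φ.trace = σ.trace) (hk1 : ∀ v, φ *ᵥ v = 0 → σ *ᵥ v = 0)
    (hk2 : ∀ v, σ *ᵥ v = 0 → φ *ᵥ v = 0) {c : ℝ} (hc : 0 < c)
    (hcp : ∀ i, hφ.1.eigenvalues i ≠ 0 → c ≤ hφ.1.eigenvalues i)
    {t : ℝ} (ht : 0 < t) (hge : (σ - (t : ℂ) • φ).PosSemidef) :
    0 ≤ qRelEnt φ σ ∧ qRelEnt φ σ ≤ (((φ - σ) * (φ - σ)).trace.re) / (t * c) := by
  set p := hφ.1.eigenvalues with hp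
  set q := hσ.1.eigenvalues with hq
  set U := (hφ.1.eigenvectorUnitary : Matrix (Fin d) (Fin d) ℂ) with hUdef
  set V := (hσ.1.eigenvectorUnitary : Matrix (Fin d) (Fin d) ℂ) with hVdef
  have hU1 : star U * U = 1 := Unitary.coe_star_mul_self _
  have hU2 : U * star U = 1 := Unitary.coe_mul_star_self _
  have hV1 : star V * V = 1 := Unitary.coe_star_mul_self _
  have hV2 : V * star V = 1 := Unitary.coe_mul_star_self _
  have sφ : φ = U * diagonal (fun i => (p i : ℂ)) * star U := spec_form hφ.1
  have sσ : σ = V * diagonal (fun i => (q i : ℂ)) * star V := spec_form hσ.1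
  have lφ : matLog φ = U * diagonal (fun i => (Real.log (p i) : ℂ)) * star U := by
    rw [matLog, dif_pos hφ.1]
  have lσ : matLog σ = V * diagonal (fun i => (Real.log (q i) : ℂ)) * star V := by
    rw [matLog, dif_pos hσ.1]
  have hφU : φ * U = U * diagonal (fun i => (p i : ℂ)) := by
    conv_lhs => rw [sφ]
    rw [Matrix.mul_assoc, hU1, Matrix.mul_one]
  have hσV : σ * V = V * diagonal (fun i => (q i : ℂ)) := by
    conv_lhs => rw [sσ]
    rw [Matrix.mul_assoc, hV1, Matrix.mul_one]
  have key := tr_formula U V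
  have hov1 : ∀ i j, p i = 0 → q j = 0 ∨ (star U * V) i j = 0 := fun i j h =>
    overlap hφ.1 hσ.1 hφU hσV hk1 h
  have hov2 : ∀ i j, q j = 0 → p i = 0 ∨ (star U * V) i j = 0 := fun i j h => by
    rcases overlap (j := i) hσ.1 hφ.1 hσV hφU hk2 h with h | h
    · exact Or.inl h
    · right
      have e : star U * V = star (star V * U) := by rw [star_mul, star_star]
      rw [e, Matrix.star_apply, h, star_zero]
  set W := star U * V with hW
  have hWW : star W * W = 1 := by
    rw [hW, star_mul, star_star, Matrix.mul_assoc, ← Matrix.mul_assoc U, hU2, Matrix.one_mul, hV1]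
  set w : Fin d → Fin d → ℝ := fun i j => Complex.normSq (W i j) with hw
  have hw0 : ∀ i j, 0 ≤ w i j := fun i j => Complex.normSq_nonneg _
  have hiff : ∀ i j, w i j ≠ 0 → (p i = 0 ↔ q j = 0) := by
    intro i j h
    have h' : W i j ≠ 0 := fun e => h (by simp [hw, e])
    exact ⟨fun e => (hov1 i j e).resolve_right h', fun e => (hov2 i j e).resolve_right h'⟩
  have hp0 : ∀ i, 0 ≤ p i := hφ.eigenvalues_nonneg
  have hq0 : ∀ i, 0 ≤ q i := hσ.eigenvalues_nonneg
  -- column sums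
  have hcol : ∀ j, ∑ i, w i j = 1 := by
    intro j
    have := congrArg Complex.re (congrFun (congrFun hWW j) j)
    rw [Matrix.mul_apply, Complex.re_sum] at this
    simp only [Matrix.one_apply_eq, Complex.one_re] at this
    rw [← this]
    refine Finset.sum_congr rfl fun i _ => ?_
    simp [hw, Matrix.star_apply, Complex.normSq_apply]
  have hVφ : ∀ j, (star V * φ * V) j j = ((∑ i, w i j * p i : ℝ) : ℂ) := by
    intro j
    have e : star V * φ * V = star W * diagonal (fun i => (p i : ℂ)) * W := by
      conv_lhs => rw [sφ]
      rw [hW, star_mul, star_star]; simp only [Matrix.mul_assoc]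
    rw [e, Matrix.mul_apply, Complex.ofReal_sum]
    refine Finset.sum_congr rfl fun i _ => ?_
    rw [Matrix.mul_diagonal, Matrix.star_apply, Complex.ofReal_mul, Complex.normSq_eq_conj_mul_self]
    simp only [RCLike.star_def]
    ring
  have hVσ : ∀ j, (star V * σ * V) j j = (q j : ℂ) := by
    intro j
    rw [Matrix.mul_assoc, hσV, ← Matrix.mul_assoc, hV1, Matrix.one_mul, Matrix.diagonal_apply_eq]
  have hqc : ∀ j, q j ≠ 0 → t * c ≤ q j := by
    intro j hj
    have h1 := (hge.conjTranspose_mul_mul_same V).diag_nonneg (i := j)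
    rw [← Matrix.star_eq_conjTranspose, Matrix.mul_sub, Matrix.sub_mul, Matrix.sub_apply, hVσ,
      Matrix.mul_smul, Matrix.smul_mul, Matrix.smul_apply, hVφ, smul_eq_mul] at h1
    have h2 : t * ∑ i, w i j * p i ≤ q j := by
      have : (0:ℂ) ≤ ((q j - t * ∑ i, w i j * p i : ℝ) : ℂ) := by
        push_cast; push_cast at h1; exact h1
      have := Complex.zero_le_real.1 this
      linarith
    have h3 : c ≤ ∑ i, w i j * p i := by
      calc c = ∑ i, w i j * c := by rw [← Finset.sum_mul, hcol, one_mul]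
        _ ≤ _ := by
          refine Finset.sum_le_sum fun i _ => ?_
          by_cases h : w i j = 0
          · simp [h]
          · exact mul_le_mul_of_nonneg_left
              (hcp i fun e => hj ((hiff i j h).1 e)) (hw0 i j)
    exact (mul_le_mul_of_nonneg_left h3 ht.le).trans h2
  -- entropy formula
  have hent : qRelEnt φ σ = ∑ i, ∑ j, w i j * (p i * (Real.log (p i) - Real.log (q j))) := by
    have e1 : (φ * matLog φ).trace.re = ∑ i, ∑ j, w i j * ((p i * Real.log (p i)) * 1) := by
      have := key (fun i => p i * Real.log (p i)) (fun _ => 1)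
      rw [uconj_one hV2, Matrix.mul_one, ← uconj_mul hU1, ← sφ, ← lφ] at this
      exact this
    have e2 : (φ * matLog σ).trace.re = ∑ i, ∑ j, w i j * (p i * Real.log (q j)) := by
      have := key p (fun j => Real.log (q j))
      rw [← sφ, ← lσ] at this
      exact this
    rw [qRelEnt, Matrix.mul_sub, Matrix.trace_sub, Complex.sub_re, e1, e2, ← Finset.sum_sub_distrib]
    refine Finset.sum_congr rfl fun i _ => ?_
    rw [← Finset.sum_sub_distrib]
    exact Finset.sum_congr rfl fun j _ => by ring
  have t1 : φ.trace.re = ∑ i, ∑ j, w i j * (p i * 1) := by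
    have := key p (fun _ => 1)
    rwa [uconj_one hV2, Matrix.mul_one, ← sφ] at this
  have t2 : σ.trace.re = ∑ i, ∑ j, w i j * (1 * q j) := by
    have := key (fun _ => 1) q
    rwa [uconj_one hU2, Matrix.one_mul, ← sσ] at this
  have hlin : ∑ i, ∑ j, w i j * (p i - q j) = 0 := by
    have : ∑ i, ∑ j, w i j * (p i - q j) = φ.trace.re - σ.trace.re := by
      rw [t1, t2, ← Finset.sum_sub_distrib]
      refine Finset.sum_congr rfl fun i _ => ?_
      rw [← Finset.sum_sub_distrib]
      exact Finset.sum_congr rfl fun j _ => by ring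
    rw [this, htr, sub_self]
  have s1 : (φ * φ).trace.re = ∑ i, ∑ j, w i j * ((p i * p i) * 1) := by
    have := key (fun i => p i * p i) (fun _ => 1)
    rwa [uconj_one hV2, Matrix.mul_one, ← uconj_mul hU1, ← sφ] at this
  have s2 : (σ * σ).trace.re = ∑ i, ∑ j, w i j * (1 * (q j * q j)) := by
    have := key (fun _ => 1) (fun j => q j * q j)
    rwa [uconj_one hU2, Matrix.one_mul, ← uconj_mul hV1, ← sσ] at this
  have s3 : (φ * σ).trace.re = ∑ i, ∑ j, w i j * (p i * q j) := by
    have := key p q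
    rwa [← sφ, ← sσ] at this
  have hsq : ((φ - σ) * (φ - σ)).trace.re = ∑ i, ∑ j, w i j * (p i - q j) ^ 2 := by
    have : ((φ - σ) * (φ - σ)).trace.re
        = (φ * φ).trace.re - (φ * σ).trace.re - (φ * σ).trace.re + (σ * σ).trace.re := by
      rw [Matrix.sub_mul, Matrix.mul_sub, Matrix.mul_sub]
      simp only [Matrix.trace_sub, Complex.sub_re, Matrix.trace_mul_comm σ φ]
      ring
    rw [this, s1, s2, s3]
    simp only [← Finset.sum_sub_distrib, ← Finset.sum_add_distrib]
    exact Finset.sum_congr rfl fun i _ => Finset.sum_congr rfl fun j _ => by ring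
  constructor
  · rw [hent, ← hlin]
    refine Finset.sum_le_sum fun i _ => Finset.sum_le_sum fun j _ => ?_
    by_cases h : w i j = 0
    · simp [h]
    · exact mul_le_mul_of_nonneg_left (scal_lower (hp0 i) (hq0 j) (hiff i j h)) (hw0 i j)
  · have : ((φ - σ) * (φ - σ)).trace.re / (t * c)
        = ∑ i, ∑ j, w i j * ((p i - q j) + (p i - q j) ^ 2 / (t * c)) := by
      simp only [mul_add, Finset.sum_add_distrib, hlin, zero_add, hsq, Finset.sum_div, mul_div_assoc]
    rw [this, hent]
    refine Finset.sum_le_sum fun i _ => Finset.sum_le_sum fun j _ => ?_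
    by_cases h : w i j = 0
    · simp [h]
    · exact mul_le_mul_of_nonneg_left
        (scal_upper (mul_pos ht hc) (hp0 i) (hq0 j) (hiff i j h) (hqc j)) (hw0 i j)

theorem exists_c {d : ℕ} (p : Fin d → ℝ) (hp : ∀ i, 0 ≤ p i) :
    ∃ c : ℝ, 0 < c ∧ ∀ i, p i ≠ 0 → c ≤ p i := by
  have h : ∀ i, ∀ᶠ c in nhdsWithin (0:ℝ) (Set.Ioi 0), p i ≠ 0 → c ≤ p i := by
    intro i
    by_cases h : p i = 0
    · simp [h]
    · have h' : 0 < p i := lt_of_le_of_ne (hp i) (Ne.symm h)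
      filter_upwards [Ioo_mem_nhdsGT h'] with c hc _ using hc.2.le
  obtain ⟨c, hc, hc0⟩ := ((Filter.eventually_all.2 h).and self_mem_nhdsWithin).exists
  exact ⟨c, hc0, hc⟩

/-- If `supp ρ ⊆ supp φ`, then `((1−λ)/λ) S(φ‖(1−λ)φ+λρ) → 0` as `λ → 0⁺`; each of the
relative entropies appearing here is finite since `supp φ ⊆ supp((1−λ)φ+λρ)`. -/
theorem relEnt_mixture_rate_tendsto_zero {d : ℕ} (hd : 1 ≤ d)
    (ρ φ : Matrix (Fin d) (Fin d) ℂ) (hρ : IsDensity ρ) (hφ : IsDensity φ)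
    (hsupp : SuppLE ρ φ) :
    (∀ l ∈ Set.Ioo (0 : ℝ) 1, SuppLE φ ((1 - (l : ℂ)) • φ + (l : ℂ) • ρ)) ∧
    Filter.Tendsto
      (fun l : ℝ => ((1 - l) / l) * qRelEnt φ ((1 - (l : ℂ)) • φ + (l : ℂ) • ρ))
      (nhdsWithin 0 (Set.Ioi 0)) (nhds 0) := by
  refine ⟨fun l hl => supp_part hρ.1 hφ.1 hsupp hl, ?_⟩
  obtain ⟨c, hc, hcp⟩ := exists_c hφ.1.1.eigenvalues hφ.1.eigenvalues_nonneg
  set K := ((φ - ρ) * (φ - ρ)).trace.re with hK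
  have hb : ∀ l ∈ Set.Ioo (0 : ℝ) 1,
      0 ≤ ((1 - l) / l) * qRelEnt φ ((1 - (l : ℂ)) • φ + (l : ℂ) • ρ) ∧
      ((1 - l) / l) * qRelEnt φ ((1 - (l : ℂ)) • φ + (l : ℂ) • ρ) ≤ l * (K / c) := by
    intro l hl
    have hl0 := hl.1
    have hl1 : 0 < 1 - l := sub_pos.2 hl.2
    have hsub : (1 - (l : ℂ)) • φ + (l : ℂ) • ρ - ((1 - l : ℝ) : ℂ) • φ = (l : ℂ) • ρ := by
      push_cast; abel
    have hdiff : φ - ((1 - (l : ℂ)) • φ + (l : ℂ) • ρ) = (l : ℂ) • (φ - ρ) := by module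
    obtain ⟨h1, h2⟩ := ent_bound (σ := (1 - (l : ℂ)) • φ + (l : ℂ) • ρ) hφ.1
      (sigma_psd hρ.1 hφ.1 hl)
      (by rw [Matrix.trace_add, Matrix.trace_smul, Matrix.trace_smul, hφ.2, hρ.2]; simp)
      (fun v h => by
        rw [Matrix.add_mulVec, Matrix.smul_mulVec, Matrix.smul_mulVec, h,
          ker_rho hρ.1 hφ.1 hsupp h]; simp)
      (fun v h => ker_sigma hρ.1 hφ.1 hl h) hc hcp hl1
      (by rw [hsub]; exact hρ.1.smul (by exact_mod_cast hl0.le))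
    have hKl : (((φ - ((1 - (l : ℂ)) • φ + (l : ℂ) • ρ)) *
        (φ - ((1 - (l : ℂ)) • φ + (l : ℂ) • ρ))).trace.re) = l * (l * K) := by
      rw [hdiff, Matrix.smul_mul, Matrix.mul_smul, Matrix.trace_smul, Matrix.trace_smul,
        smul_eq_mul, smul_eq_mul, Complex.re_ofReal_mul, Complex.re_ofReal_mul]
    rw [hKl] at h2
    have hpos : 0 < (1 - l) / l := div_pos hl1 hl0
    refine ⟨mul_nonneg hpos.le h1, (mul_le_mul_of_nonneg_left h2 hpos.le).trans (le_of_eq ?_)⟩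
    field_simp
  have hlim : Filter.Tendsto (fun l : ℝ => l * (K / c)) (nhdsWithin 0 (Set.Ioi 0)) (nhds 0) := by
    have : Filter.Tendsto (fun l : ℝ => l * (K / c)) (nhds 0) (nhds (0 * (K / c))) :=
      (continuous_id.mul continuous_const).tendsto 0
    rw [zero_mul] at this
    exact this.mono_left nhdsWithin_le_nhds
  have hev := Ioo_mem_nhdsGT (zero_lt_one' ℝ)
  refine tendsto_of_tendsto_of_tendsto_of_le_of_le' tendsto_const_nhds hlim ?_ ?_
  · filter_upwards [hev] with l hl using (hb l hl).1
  · filter_upwards [hev] with l hl using (hb l hl).2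
end

section
/- Let L be a linear map on d×d complex matrices such that for every t ≥ 0 the semigroup element exp(tL) is positive and trace-preserving, and let Q̇ be a real-linear functional on Hermitian matrices. Define the EP rate Σ̇(ρ) as the right derivative at t = 0 of t ↦ S(exp(tL)ρ) plus Q̇(ρ), which is well-defined and finite whenever supp L(ρ) ⊆ supp ρ. Let P be a finite set of pairwise orthogonal projection matrices and D_P the set of density matrices ρ with ρ = Σ_{Π∈P} Π ρ Π. Suppose φ ∈ D_P satisfies supp L(φ) ⊆ supp φ and Σ̇(φ) ≤ Σ̇(ω) for every ω ∈ D_P with supp L(ω) ⊆ supp ω. Then for every ρ ∈ D_P with supp ρ ⊆ supp φ and supp L(ρ) ⊆ supp ρ, one has Σ̇(ρ) − Σ̇(φ) = −(d/dt)|_{t=0⁺} S(exp(tL)ρ ‖ exp(tL)φ), where the relative entropy is finite for all small t ≥ 0 since supp(exp(tL)ρ) ⊆ supp(exp(tL)φ). -/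
open Matrix
open scoped ComplexOrder

/-- The set of density matrices that are incoherent relative to the projections in `P`,
i.e. `ρ = ∑_{Π ∈ P} Π ρ Π`. -/
def DP {d : ℕ} (P : Finset (Matrix (Fin d) (Fin d) ℂ)) : Set (Matrix (Fin d) (Fin d) ℂ) :=
  {ρ | IsDensity ρ ∧ ρ = ∑ pr ∈ P, pr * ρ * pr}

/-- `P` is a finite set of pairwise orthogonal (Hermitian, idempotent) projection matrices. -/
def IsOrthProjFamily {d : ℕ} (P : Finset (Matrix (Fin d) (Fin d) ℂ)) : Prop :=
  (∀ pr ∈ P, pr.IsHermitian ∧ pr * pr = pr) ∧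
    (∀ pr ∈ P, ∀ pr' ∈ P, pr ≠ pr' → pr * pr' = 0)

/-- The semigroup element `exp(tL)` of a linear map `L` on `d×d` matrices, computed via the
matrix representation of `L` in the standard basis. -/
noncomputable def endExp {d : ℕ} (L : Matrix (Fin d) (Fin d) ℂ →ₗ[ℂ] Matrix (Fin d) (Fin d) ℂ)
    (t : ℝ) : Matrix (Fin d) (Fin d) ℂ →ₗ[ℂ] Matrix (Fin d) (Fin d) ℂ :=
  Matrix.toLin (Matrix.stdBasis ℂ (Fin d) (Fin d)) (Matrix.stdBasis ℂ (Fin d) (Fin d))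
    (NormedSpace.exp ((t : ℂ) •
      LinearMap.toMatrix (Matrix.stdBasis ℂ (Fin d) (Fin d))
        (Matrix.stdBasis ℂ (Fin d) (Fin d)) L))

/-- The EP rate `Σ̇(ρ)`: the right derivative at `t = 0` of `t ↦ S(exp(tL)ρ)`, plus `Q̇(ρ)`. -/
noncomputable def EPrate {d : ℕ} (L : Matrix (Fin d) (Fin d) ℂ →ₗ[ℂ] Matrix (Fin d) (Fin d) ℂ)
    (Qd : Matrix (Fin d) (Fin d) ℂ →ₗ[ℝ] ℝ) (ρ : Matrix (Fin d) (Fin d) ℂ) : ℝ :=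
  derivWithin (fun t : ℝ => vN (endExp L t ρ)) (Set.Ici 0) 0 + Qd ρ


open scoped RightActions in
theorem logser {𝔸 : Type*} [NormedRing 𝔸] [NormedAlgebra ℝ 𝔸] [CompleteSpace 𝔸] [NormOneClass 𝔸]
    (x0 : 𝔸) (hx0 : ‖x0‖ < 1) : ∃ D : 𝔸 →L[ℝ] 𝔸,
    HasFDerivAt (fun x : 𝔸 => ∑' n : ℕ, ((n + 1 : ℝ)⁻¹) • x ^ (n + 1)) D x0 ∧
    (∀ τ : 𝔸 →L[ℝ] ℝ, (∀ a b, τ (a * b) = τ (b * a)) → ∀ X Y, τ (X * D Y) = τ (Y * D X)) ∧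
    (∀ Y, Commute x0 Y → (1 - x0) * D Y = Y) := by
  obtain ⟨r, hr1, hr2⟩ := exists_between hx0
  have hr0 : 0 ≤ r := (norm_nonneg _).trans hr1.le
  let f' : ℕ → 𝔸 → 𝔸 →L[ℝ] 𝔸 := fun n x => ((n + 1 : ℝ)⁻¹) •
    (∑ i ∈ Finset.range (n + 1), x ^ (n - i) •> ContinuousLinearMap.id ℝ 𝔸 <• x ^ i)
  have hf'app : ∀ n x y, f' n x y = ((n + 1 : ℝ)⁻¹) • ∑ i ∈ Finset.range (n + 1), x ^ (n - i) * y * x ^ i := by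
    intro n x y
    simp [f']
    try simp [mul_assoc]
  have hbound : ∀ n x, x ∈ Metric.ball (0 : 𝔸) r → ‖f' n x‖ ≤ r ^ n := by
    intro n x hx
    have hx' : ‖x‖ ≤ r := by simpa using (mem_ball_zero_iff.1 hx).le
    refine ContinuousLinearMap.opNorm_le_bound _ (by positivity) fun y => ?_
    rw [hf'app, norm_smul, Real.norm_of_nonneg (by positivity)]
    have h1 : ‖∑ i ∈ Finset.range (n + 1), x ^ (n - i) * y * x ^ i‖ ≤
        ∑ i ∈ Finset.range (n + 1), r ^ n * ‖y‖ := by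
      refine norm_sum_le_of_le _ fun i hi => ?_
      have hi' : i ≤ n := by simpa [Nat.lt_succ_iff] using hi
      calc ‖x ^ (n - i) * y * x ^ i‖ ≤ ‖x ^ (n - i)‖ * ‖y‖ * ‖x ^ i‖ := norm_mul₃_le
        _ ≤ ‖x‖ ^ (n - i) * ‖y‖ * ‖x‖ ^ i := by gcongr <;> exact norm_pow_le _ _
        _ ≤ r ^ (n - i) * ‖y‖ * r ^ i := by gcongr
        _ = r ^ (n - i + i) * ‖y‖ := by rw [pow_add]; ring
        _ = _ := by rw [Nat.sub_add_cancel hi']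
    calc (n + 1 : ℝ)⁻¹ * ‖∑ i ∈ Finset.range (n + 1), x ^ (n - i) * y * x ^ i‖
        ≤ (n + 1 : ℝ)⁻¹ * ∑ i ∈ Finset.range (n + 1), r ^ n * ‖y‖ := by gcongr
      _ = r ^ n * ‖y‖ := by
        simp only [Finset.sum_const, Finset.card_range, nsmul_eq_mul]; push_cast; field_simp
  have hmem : x0 ∈ Metric.ball (0 : 𝔸) r := by simpa using hr1
  have hu : Summable fun n : ℕ => r ^ n := summable_geometric_of_lt_one hr0 hr2
  have hsumD : Summable fun n => f' n x0 :=
    Summable.of_norm_bounded hu (fun n => hbound n x0 hmem)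
  refine ⟨∑' n, f' n x0, ?_, ?_, ?_⟩
  · refine hasFDerivAt_tsum_of_isPreconnected (s := Metric.ball (0 : 𝔸) r) hu Metric.isOpen_ball
      (convex_ball _ _).isPreconnected (fun n x hx => ?_) hbound
      (x₀ := 0) (by rw [Metric.mem_ball, dist_self]; exact (norm_nonneg _).trans_lt hr1) (by simp) hmem
    have := (hasFDerivAt_pow' (𝕜 := ℝ) (n + 1) (x := x)).const_smul ((n + 1 : ℝ)⁻¹)
    exact this
  · intro τ hτ X Y
    have key : ∀ X Y, τ (X * (∑' n, f' n x0) Y) = ∑' n, τ (X * f' n x0 Y) := by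
      intro X Y
      have h1 := (hsumD.hasSum.mapL (ContinuousLinearMap.apply ℝ 𝔸 Y))
      have h2 := (h1.mul_left X).mapL τ
      exact h2.tsum_eq.symm
    rw [key, key]
    congr 1; ext n
    rw [hf'app, hf'app]
    simp only [mul_smul_comm, map_smul, Finset.mul_sum, map_sum]
    congr 1
    rw [← Finset.sum_range_reflect]
    refine Finset.sum_congr rfl fun i hi => ?_
    have hi' : i ≤ n := by simpa [Nat.lt_succ_iff] using hi
    have e1 : n + 1 - 1 - i = n - i := by omega
    rw [e1, Nat.sub_sub_self hi', hτ X, hτ Y]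
    rw [hτ _ Y, hτ _ X]
    have : ∀ a b X Y : 𝔸, τ (X * (a * Y * b)) = τ (Y * (b * X * a)) := by
      intro a b X Y
      have := hτ (X * a) (Y * b)
      have := hτ (Y * b * X) a
      have := hτ (X * a * Y) b
      simp only [mul_assoc] at *
      rw [hτ X]; simp only [mul_assoc]
      rw [hτ a]; simp only [mul_assoc]
    rw [this]
  · intro Y hY
    have h1 := (hsumD.hasSum.mapL (ContinuousLinearMap.apply ℝ 𝔸 Y))
    have h2 : ∀ n, f' n x0 Y = x0 ^ n * Y := by
      intro n
      rw [hf'app]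
      have : ∀ i ∈ Finset.range (n + 1), x0 ^ (n - i) * Y * x0 ^ i = x0 ^ n * Y := by
        intro i hi
        have hi' : i ≤ n := by simpa [Nat.lt_succ_iff] using hi
        rw [mul_assoc, ← (hY.pow_left i).eq, ← mul_assoc, ← pow_add, Nat.sub_add_cancel hi']
      rw [Finset.sum_congr rfl this]
      simp only [Finset.sum_const, Finset.card_range, ← Nat.cast_smul_eq_nsmul ℝ, smul_smul]
      push_cast
      rw [inv_mul_cancel₀ (by positivity), one_smul]
    have h3 : (∑' n, f' n x0) Y = (∑' n, x0 ^ n) * Y := by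
      have := (summable_geometric_of_norm_lt_one hx0).hasSum.mul_right Y
      have h1' : HasSum (fun n => f' n x0 Y) ((∑' n, f' n x0) Y) := h1
      simp only [h2] at h1'
      exact h1'.unique this
    rw [h3, ← mul_assoc, mul_neg_geom_series x0 hx0, one_mul]

section aux
open scoped Matrix.Norms.L2Operator MatrixOrder
open Filter Topology

abbrev Mat (d : ℕ) := Matrix (Fin d) (Fin d) ℂ

structure KP {d : ℕ} (φ Q : Mat d) : Prop where
  h1 : φ.IsHermitian
  h2 : Q.IsHermitian
  h3 : Q * Q = Q
  h4 : Q * φ = 0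
  h5 : (φ + Q).PosDef

theorem KP.h4' {d : ℕ} {φ Q : Mat d} (h : KP φ Q) : φ * Q = 0 := by
  have := congrArg conjTranspose h.h4
  rwa [conjTranspose_mul, h.h1.eq, h.h2.eq, conjTranspose_zero] at this

theorem spectral_decomp {d : ℕ} {A : Mat d} (hA : A.IsHermitian) :
    A = (hA.eigenvectorUnitary : Mat d) * diagonal (fun i => (hA.eigenvalues i : ℂ)) *
      star (hA.eigenvectorUnitary : Mat d) := by
  conv_lhs => rw [hA.spectral_theorem, Unitary.conjStarAlgAut_apply]
  rfl

theorem kp_exists {d : ℕ} {φ : Mat d} (hφ : φ.PosSemidef) : ∃ Q, KP φ Q := by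
  classical
  have hA := hφ.isHermitian
  set U : Mat d := (hA.eigenvectorUnitary : Mat d) with hU
  have hUU : star U * U = 1 := by simp [hU]
  have hUU' : U * star U = 1 := by simp [hU]
  have hdec := spectral_decomp hA
  rw [← hU] at hdec
  set Λ : Mat d := diagonal (fun i => (hA.eigenvalues i : ℂ)) with hΛ
  let R : Mat d := diagonal (fun i => if hA.eigenvalues i = 0 then (1 : ℂ) else 0)
  have hRR : R * R = R := by
    simp only [R, diagonal_mul_diagonal]; congr 1; ext i; split_ifs <;> simp
  have hRΛ : R * Λ = 0 := by
    simp only [R, Λ, diagonal_mul_diagonal]; rw [← diagonal_zero]; congr 1; ext i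
    split_ifs with h <;> simp [h]
  have hRH : R.IsHermitian := by
    simp only [R]
    apply isHermitian_diagonal_of_self_adjoint
    ext i; simp [apply_ite]
  have hcomb : ∀ A B : Mat d, (U * A * star U) * (U * B * star U) = U * (A * B) * star U := by
    intro A B
    calc _ = U * A * (star U * U) * B * star U := by simp only [mul_assoc]
      _ = _ := by rw [hUU]; simp only [mul_assoc, mul_one, one_mul]
  refine ⟨U * R * star U, hA, ?_, ?_, ?_, ?_⟩
  · exact isHermitian_mul_mul_conjTranspose U hRH
  · rw [hcomb, hRR]
  · rw [hdec, hcomb, hRΛ]; simp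
  · have e : φ + U * R * star U = U * (Λ + R) * star U := by
      conv_lhs => rw [hdec]
      noncomm_ring
    rw [e]
    have hd : (Λ + R).PosDef := by
      simp only [Λ, R, diagonal_add]
      rw [posDef_diagonal_iff]
      intro i
      have := hφ.eigenvalues_nonneg i
      split_ifs with h
      · simp [h]
      · simp; exact lt_of_le_of_ne this (Ne.symm h)
    have hUu : IsUnit U := ⟨⟨U, star U, hUU', hUU⟩, rfl⟩
    exact (Matrix.IsUnit.posDef_star_right_conjugate_iff hUu).2 hd

theorem suppLE_of {d : ℕ} {φ Q X : Mat d} (hu : IsUnit (φ + Q)) (h3 : Q * Q = Q)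
    (h4 : Q * φ = 0) (hX : Q * X = 0) : SuppLE X φ := by
  obtain ⟨u, hu⟩ := hu
  have e1 : (φ + Q) * (↑u⁻¹ : Mat d) = 1 := by rw [← hu]; simp
  have e2 : Q * (↑u⁻¹ : Mat d) = Q := by
    have : Q * ((φ + Q) * (↑u⁻¹ : Mat d)) = Q := by rw [e1, mul_one]
    rwa [← mul_assoc, mul_add, h4, h3, zero_add] at this
  have e3 : X = φ * ((↑u⁻¹ : Mat d) * X) := by
    calc X = (φ + Q) * (↑u⁻¹ : Mat d) * X := by rw [e1, one_mul]
      _ = φ * ((↑u⁻¹ : Mat d) * X) + Q * (↑u⁻¹ : Mat d) * X := by noncomm_ring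
      _ = _ := by rw [e2, hX, add_zero]
  rintro _ ⟨v, rfl⟩
  refine ⟨((↑u⁻¹ : Mat d) * X) *ᵥ v, ?_⟩
  simp only [mulVecLin_apply]
  rw [mulVec_mulVec, ← e3]

theorem suppLE_imp {d : ℕ} {φ Q X : Mat d} 
    (h4 : Q * φ = 0) (hX : SuppLE X φ) : Q * X = 0 := by
  refine Matrix.ext_of_mulVec_single fun i => ?_
  obtain ⟨w, hw⟩ := hX ⟨Pi.single i 1, rfl⟩
  simp only [mulVecLin_apply] at hw
  rw [← mulVec_mulVec, ← hw, mulVec_mulVec, h4, zero_mulVec, zero_mulVec]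

theorem lower_bd {d : ℕ} [NeZero d] {A : Mat d} (hA : A.PosDef) : ∃ r : ℝ, 0 < r ∧ (A - r • (1 : Mat d)).PosSemidef := by
  have h := (CFC.exists_pos_algebraMap_le_iff (A := Mat d) (a := A) hA.isHermitian).2
    (fun x hx => (isStrictlyPositive_iff_posDef.2 hA).spectrum_pos hx)
  obtain ⟨r, hr, h⟩ := h
  refine ⟨r, hr, ?_⟩
  rw [Algebra.algebraMap_eq_smul_one] at h
  exact h

theorem kp_norm {d : ℕ} [NeZero d] {φ Q : Mat d} (h : KP φ Q) (hφ : IsDensity φ) : ‖1 - (φ + Q)‖ < 1 := by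
  obtain ⟨r, hr, hr1⟩ := lower_bd h.h5
  have hle : (1 - φ).PosSemidef := by
    have hA := hφ.1.isHermitian
    have hdec := spectral_decomp hA
    set U : Mat d := (hA.eigenvectorUnitary : Mat d) with hU
    have hUU : star U * U = 1 := by simp [hU]
    have hUU' : U * star U = 1 := by simp [hU]
    have hUu : IsUnit U := ⟨⟨U, star U, hUU', hUU⟩, rfl⟩
    have e : 1 - φ = U * diagonal (fun i => 1 - (hA.eigenvalues i : ℂ)) * star U := by
      have e1 : diagonal (fun i => 1 - (hA.eigenvalues i : ℂ)) =
        (1 : Mat d) - diagonal (fun i => (hA.eigenvalues i : ℂ)) := by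
        rw [← diagonal_one, diagonal_sub]
      rw [e1, mul_sub, sub_mul, mul_one, hUU', ← hdec]
    rw [e]
    refine (Matrix.IsUnit.posSemidef_star_right_conjugate_iff hUu).2 ?_
    rw [posSemidef_diagonal_iff]
    intro i
    have ht : ∑ j, hA.eigenvalues j = 1 := by
      have := hA.trace_eq_sum_eigenvalues
      rw [hφ.2] at this
      have h7 := congrArg Complex.re this
      simpa using h7.symm
    have := Finset.single_le_sum (f := hA.eigenvalues) (fun j _ => hφ.1.eigenvalues_nonneg j) (Finset.mem_univ i)
    rw [ht] at this
    have h0 : (0 : ℝ) ≤ 1 - hA.eigenvalues i := by linarith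
    exact_mod_cast h0
  have hle2 : (1 - (φ + Q)).PosSemidef := by
    have := hle.mul_mul_conjTranspose_same (1 - Q)
    have e : (1 - Q) * (1 - φ) * (1 - Q)ᴴ = 1 - (φ + Q) := by
      rw [conjTranspose_sub, conjTranspose_one, h.h2.eq]
      have e1 : (1 - Q) * (1 - φ) * (1 - Q) = 1 - φ - Q - Q + Q * Q + Q * φ  + φ * Q - Q * φ * Q := by noncomm_ring
      rw [e1, h.h3, h.h4, h.h4']; simp; abel
    rwa [e] at this
  have hr2 : 1 - (φ + Q) ≤ algebraMap ℝ (Mat d) (1 - r) := by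
    rw [le_iff, Algebra.algebraMap_eq_smul_one]
    have e : (1 - r) • (1 : Mat d) - (1 - (φ + Q)) = φ + Q - r • (1 : Mat d) := by
      rw [sub_smul, one_smul]; abel
    rw [e]; exact hr1
  rcases le_or_gt r 1 with h1 | h1
  · have := (CStarAlgebra.norm_le_iff_le_algebraMap (1 - (φ + Q)) (r := 1 - r) (by linarith) (nonneg_iff_posSemidef.2 hle2)).2 hr2
    linarith
  · have := (CStarAlgebra.norm_le_iff_le_algebraMap (1 - (φ + Q)) (r := 0) (by linarith) (nonneg_iff_posSemidef.2 hle2)).2 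
      (hr2.trans (by
        rw [le_iff, ← map_sub, Algebra.algebraMap_eq_smul_one]
        exact PosSemidef.one.smul (by linarith)))
    linarith

theorem matLog_eq {d : ℕ} {φ Q : Mat d} (h1 : φ.IsHermitian) (h2 : Q.IsHermitian) (h3 : Q * Q = Q)
    (h4 : Q * φ = 0) (hn : ‖1 - (φ + Q)‖ < 1) :
    matLog φ = - ∑' n : ℕ, ((n + 1 : ℝ)⁻¹) • (1 - (φ + Q)) ^ (n + 1) := by
  classical
  have hu : IsUnit (φ + Q) := by
    have := (isUnit_one_sub_of_norm_lt_one hn)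
    rwa [sub_sub_cancel] at this
  rw [matLog, dif_pos h1]
  have hdec := spectral_decomp h1
  set U : Mat d := (h1.eigenvectorUnitary : Mat d) with hU
  have hUU : star U * U = 1 := by simp [hU]
  have hUU' : U * star U = 1 := by simp [hU]
  set Λ : Mat d := diagonal (fun i => (h1.eigenvalues i : ℂ)) with hΛ
  let R : Mat d := diagonal (fun i => if h1.eigenvalues i = 0 then (1 : ℂ) else 0)
  have hφQ : φ * Q = 0 := by
    have := congrArg conjTranspose h4
    rwa [conjTranspose_mul, h1.eq, h2.eq, conjTranspose_zero] at this
  have hQ' : star U * Q * U * Λ = 0 := by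
    calc star U * Q * U * Λ = star U * Q * (U * Λ * star U) * U := by
          simp only [mul_assoc, hUU, mul_one]
      _ = 0 := by rw [← hdec, mul_assoc (star U), h4]; simp
  have hQR : star U * Q * U * R = star U * Q * U := by
    ext i j
    have := congrFun (congrFun hQ' i) j
    simp only [hΛ, R, mul_diagonal, Matrix.zero_apply] at this ⊢
    split_ifs with h
    · simp
    · have h' : (h1.eigenvalues j : ℂ) ≠ 0 := by exact_mod_cast h
      rcases mul_eq_zero.1 this with h0 | h0
      · rw [h0]; simp
      · exact absurd h0 h'
  have hΛR : Λ * R = 0 := by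
    simp only [R, Λ, diagonal_mul_diagonal]; rw [← diagonal_zero]; congr 1; ext i
    split_ifs with h <;> simp [h]
  have hQeq : Q = U * R * star U := by
    have e1 : (φ + Q) * (U * R * star U) = (φ + Q) * Q := by
      rw [add_mul, add_mul, hφQ, h3]
      have a1 : φ * (U * R * star U) = 0 := by
        calc φ * (U * R * star U) = (U * Λ * star U) * (U * R * star U) := by rw [← hdec]
          _ = U * (Λ * (star U * U) * R) * star U := by simp only [mul_assoc]
          _ = 0 := by rw [hUU, mul_one, hΛR]; simp
      have a2 : Q * (U * R * star U) = Q := by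
        calc Q * (U * R * star U) = (U * star U) * Q * (U * R * star U) := by rw [hUU', one_mul]
          _ = U * (star U * Q * U * R) * star U := by simp only [mul_assoc]
          _ = (U * star U) * Q * (U * star U) := by rw [hQR]; simp only [mul_assoc]
          _ = Q := by rw [hUU', one_mul, mul_one]
      rw [a1, a2]
    exact (hu.mul_left_cancel e1).symm
  let μ : Fin d → ℝ := fun i => 1 - (h1.eigenvalues i + if h1.eigenvalues i = 0 then 1 else 0)
  have hx : 1 - (φ + Q) = U * diagonal (fun i => (μ i : ℂ)) * star U := by
    have e1 : diagonal (fun i => (μ i : ℂ)) = 1 - (Λ + R) := by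
      simp only [μ, Λ, R, diagonal_add]
      rw [← diagonal_one, diagonal_sub]
      congr 1; ext i; push_cast; split_ifs <;> simp
    rw [e1, mul_sub, sub_mul, mul_one, hUU', mul_add, add_mul, ← hQeq, ← hdec]
  have hpow : ∀ n, (1 - (φ + Q)) ^ n = U * diagonal (fun i => (μ i : ℂ) ^ n) * star U := by
    intro n
    induction n with
    | zero => simp [hUU']
    | succ n ih =>
      rw [pow_succ, ih, hx]
      calc _ = U * (diagonal (fun i => (μ i : ℂ) ^ n) * (star U * U) * diagonal (fun i => (μ i : ℂ))) * star U := by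
            simp only [mul_assoc]
        _ = _ := by rw [hUU, mul_one, diagonal_mul_diagonal]; simp only [pow_succ]
  have hμ : ∀ i, |μ i| < 1 := by
    intro i
    have e1 : diagonal (fun i => (μ i : ℂ)) = star U * (1 - (φ + Q)) * U := by
      rw [hx]
      calc _ = (star U * U) * diagonal (fun i => (μ i : ℂ)) * (star U * U) := by rw [hUU]; simp
        _ = _ := by simp only [mul_assoc]
    have e2 : ‖diagonal (fun i => (μ i : ℂ))‖ = ‖1 - (φ + Q)‖ := by
      rw [e1, hU, CStarRing.norm_mul_coe_unitary, ← Unitary.coe_star, CStarRing.norm_coe_unitary_mul]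
    rw [l2_opNorm_diagonal] at e2
    have := norm_le_pi_norm (fun i => (μ i : ℂ)) i
    simp only [Complex.norm_real, Real.norm_eq_abs] at this
    linarith
  have hs : HasSum (fun n : ℕ => ((n + 1 : ℝ)⁻¹) • (1 - (φ + Q)) ^ (n + 1))
      (U * diagonal (fun i => ((-Real.log (1 - μ i) : ℝ) : ℂ)) * star U) := by
    have h0 : HasSum (fun (n : ℕ) (i : Fin d) => (((μ i) ^ (n + 1) / (n + 1) : ℝ) : ℂ))
        (fun i => ((-Real.log (1 - μ i) : ℝ) : ℂ)) := by
      rw [Pi.hasSum]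
      intro i
      exact Complex.hasSum_ofReal.2 (Real.hasSum_pow_div_log_of_abs_lt_one (hμ i))
    have h5 := (h0.matrix_diagonal.mul_left U).mul_right (star U)
    refine h5.congr_fun ?_
    intro n
    rw [hpow, ← smul_mul_assoc, ← mul_smul_comm]
    congr 2
    ext i j
    by_cases hij : i = j
    · subst hij; simp [div_eq_inv_mul]
    · simp [hij]
  rw [hs.tsum_eq, ← neg_mul, ← mul_neg, diagonal_neg]
  congr 3
  ext i
  simp only [μ]
  push_cast
  by_cases h : h1.eigenvalues i = 0 <;> simp [h]

end aux

section aux2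
open scoped Matrix.Norms.L2Operator MatrixOrder
open Filter Topology

noncomputable def trR (d : ℕ) : Mat d →L[ℝ] ℝ :=
  LinearMap.toContinuousLinearMap
    (Complex.reLm ∘ₗ (traceLinearMap (Fin d) ℂ ℂ).restrictScalars ℝ)

theorem trR_apply {d : ℕ} (A : Mat d) : trR d A = A.trace.re := rfl

theorem trR_comm {d : ℕ} (A B : Mat d) : trR d (A * B) = trR d (B * A) := by
  rw [trR_apply, trR_apply, trace_mul_comm]

theorem trR_star {d : ℕ} (A : Mat d) : trR d Aᴴ = trR d A := by
  rw [trR_apply, trR_apply, trace_conjTranspose]; simp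

theorem trR_sq {d : ℕ} {A : Mat d} (h : trR d (Aᴴ * A) = 0) : A = 0 := by
  rw [← trace_conjTranspose_mul_self_eq_zero_iff]
  have h1 := (posSemidef_conjTranspose_mul_self A).trace_nonneg
  rw [Complex.le_def] at h1
  apply Complex.ext
  · exact h
  · exact h1.2.symm

theorem endExp_hasSum {d : ℕ} (L : Mat d →ₗ[ℂ] Mat d) (t : ℝ) (X : Mat d) :
    HasSum (fun n : ℕ => ((n.factorial : ℂ)⁻¹ * (t : ℂ) ^ n) • (L ^ n) X) (endExp L t X) := by
  set b := Matrix.stdBasis ℂ (Fin d) (Fin d) with hb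
  let F : Matrix (Fin d × Fin d) (Fin d × Fin d) ℂ →ₗ[ℂ] Mat d :=
    (LinearMap.applyₗ X) ∘ₗ (Matrix.toLin b b).toLinearMap
  have hF : Continuous F := F.continuous_of_finiteDimensional
  have h1 := (NormedSpace.exp_series_hasSum_exp' (𝕂 := ℂ) ((t : ℂ) • LinearMap.toMatrix b b L)).map F hF
  refine h1.congr_fun ?_
  intro n
  simp only [Function.comp, F, LinearMap.comp_apply, LinearEquiv.coe_coe, smul_pow, map_smul,
    LinearMap.applyₗ_apply_apply, smul_smul]
  have e : ∀ n : ℕ, LinearMap.toMatrix b b (L ^ n) = LinearMap.toMatrix b b L ^ n := by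
    intro n
    induction n with
    | zero => simp
    | succ n ih => rw [pow_succ, LinearMap.toMatrix_mul, ih, pow_succ]
  rw [← e, Matrix.toLin_toMatrix]

theorem endExp_zero {d : ℕ} (L : Mat d →ₗ[ℂ] Mat d) (X : Mat d) : endExp L 0 X = X := by
  simp [endExp]

theorem endExp_deriv {d : ℕ} (L : Mat d →ₗ[ℂ] Mat d) (X : Mat d) :
    HasDerivAt (fun t : ℝ => endExp L t X) (L X) 0 := by
  set b := Matrix.stdBasis ℂ (Fin d) (Fin d) with hb
  let F : Matrix (Fin d × Fin d) (Fin d × Fin d) ℂ →ₗ[ℂ] Mat d :=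
    (LinearMap.applyₗ X) ∘ₗ (Matrix.toLin b b).toLinearMap
  let F' : Matrix (Fin d × Fin d) (Fin d × Fin d) ℂ →L[ℝ] Mat d :=
    LinearMap.toContinuousLinearMap (F.restrictScalars ℝ)
  have h1 := hasDerivAt_exp_smul_const (𝕂 := ℝ) (LinearMap.toMatrix b b L) 0
  have h2 := F'.hasFDerivAt.comp_hasDerivAt (0 : ℝ) h1
  have e : F' (NormedSpace.exp ((0 : ℝ) • LinearMap.toMatrix b b L) * LinearMap.toMatrix b b L) = L X := by
    simp [F', F]
  rw [e] at h2
  exact h2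

theorem posDef_pert {d : ℕ} [NeZero d] {A : Mat d} (hA : A.PosDef) :
    ∃ ε : ℝ, 0 < ε ∧ ∀ Z : Mat d, Z.IsHermitian → ‖Z‖ < ε → (A + Z).PosDef := by
  obtain ⟨r, hr, h⟩ := lower_bd hA
  refine ⟨r, hr, fun Z hZ hZr => ?_⟩
  have h1 : (Z + ‖Z‖ • (1 : Mat d)).PosSemidef := by
    have := IsSelfAdjoint.neg_algebraMap_norm_le_self (a := Z) hZ
    rw [le_iff, Algebra.algebraMap_eq_smul_one, sub_neg_eq_add] at this
    exact this
  have h2 : ((r - ‖Z‖) • (1 : Mat d)).PosDef := PosDef.one.smul (by linarith)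
  have e : A + Z = (A - r • (1 : Mat d)) + ((Z + ‖Z‖ • (1 : Mat d)) + (r - ‖Z‖) • (1 : Mat d)) := by
    rw [sub_smul]; abel
  rw [e]
  exact PosDef.posSemidef_add h (PosDef.posSemidef_add h1 h2)

theorem KP.psd {d : ℕ} {φ Q : Mat d} (h : KP φ Q) : φ.PosSemidef := by
  have := h.h5.posSemidef.mul_mul_conjTranspose_same (1 - Q)
  have e : (1 - Q) * (φ + Q) * (1 - Q)ᴴ = φ := by
    rw [conjTranspose_sub, conjTranspose_one, h.h2.eq]
    have e1 : (1 - Q) * (φ + Q) * (1 - Q) = φ + Q - Q * φ - Q * Q - φ * Q - Q * Q + Q * φ * Q + (Q * Q) * Q := by noncomm_ring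
    rw [e1, h.h4, h.h4', h.h3, h.h3]; simp
  rwa [e] at this

theorem KP.pert {d : ℕ} [NeZero d] {φ Q Y : Mat d} (h : KP φ Q) (hY : Y.IsHermitian) (hQY : Q * Y = 0) :
    ∃ ε : ℝ, 0 < ε ∧ ∀ s : ℝ, |s| < ε → KP (φ + s • Y) Q := by
  obtain ⟨ε, hε, he⟩ := posDef_pert h.h5
  refine ⟨ε / (‖Y‖ + 1), by positivity, fun s hs => ?_⟩
  have hsY : (s • Y).IsHermitian := by
    rw [IsHermitian, conjTranspose_smul, hY.eq]; simp
  refine ⟨h.h1.add hsY, h.h2, h.h3, ?_, ?_⟩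
  · rw [mul_add, h.h4, mul_smul_comm, hQY]; simp
  · rw [add_right_comm]
    apply he _ hsY
    rw [norm_smul, Real.norm_eq_abs]
    rw [lt_div_iff₀ (by positivity)] at hs
    nlinarith [abs_nonneg s, norm_nonneg Y]


theorem endExp_herm {d : ℕ} [NeZero d] {L : Mat d →ₗ[ℂ] Mat d}
    (hL : ∀ t : ℝ, 0 ≤ t → IsPTP (endExp L t)) {X : Mat d} (hX : X.IsHermitian) {t : ℝ} (ht : 0 ≤ t) :
    (endExp L t X).IsHermitian := by
  have h1 : (X + ‖X‖ • (1 : Mat d)).PosSemidef := by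
    have := IsSelfAdjoint.neg_algebraMap_norm_le_self (a := X) hX
    rw [le_iff, Algebra.algebraMap_eq_smul_one, sub_neg_eq_add] at this
    exact this
  have h2 : (‖X‖ • (1 : Mat d)).PosSemidef := PosSemidef.one.smul (norm_nonneg _)
  have h3 := ((hL t ht).1 _ h1).isHermitian.sub ((hL t ht).1 _ h2).isHermitian
  rwa [← map_sub, add_sub_cancel_right] at h3

theorem L_herm {d : ℕ} [NeZero d] {L : Mat d →ₗ[ℂ] Mat d}
    (hL : ∀ t : ℝ, 0 ≤ t → IsPTP (endExp L t)) {X : Mat d} (hX : X.IsHermitian) : (L X).IsHermitian := by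
  have h1 := (endExp_deriv L X).hasDerivWithinAt (s := Set.Ici 0)
  have h2 := h1.star
  have h3 : HasDerivWithinAt (fun t : ℝ => endExp L t X) (star (L X)) (Set.Ici 0) 0 := by
    refine h2.congr (fun t ht => ?_) ?_
    · exact (endExp_herm hL hX ht).eq.symm
    · exact (endExp_herm hL hX le_rfl).eq.symm
  exact (uniqueDiffWithinAt_Ici (0 : ℝ)).eq_deriv _ h3 h1

theorem L_trace {d : ℕ} [NeZero d] {L : Mat d →ₗ[ℂ] Mat d}
    (hL : ∀ t : ℝ, 0 ≤ t → IsPTP (endExp L t)) (X : Mat d) : trR d (L X) = 0 := by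
  have h1 := (trR d).hasFDerivAt.comp_hasDerivWithinAt (0 : ℝ)
    ((endExp_deriv L X).hasDerivWithinAt (s := Set.Ici 0))
  have h3 : HasDerivWithinAt (trR d ∘ fun t : ℝ => endExp L t X) 0 (Set.Ici 0) 0 := by
    refine (hasDerivWithinAt_const (0 : ℝ) (Set.Ici 0) (trR d X)).congr (fun t ht => ?_) ?_
    · simp only [Function.comp, trR_apply, (hL t ht).2]
    · simp only [Function.comp, trR_apply, (hL 0 le_rfl).2]
  exact (uniqueDiffWithinAt_Ici (0 : ℝ)).eq_deriv _ h1 h3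

theorem condpos {d : ℕ} [NeZero d] {L : Mat d →ₗ[ℂ] Mat d}
    (hL : ∀ t : ℝ, 0 ≤ t → IsPTP (endExp L t)) {X V : Mat d} (hX : X.PosSemidef) (hXV : X * V = 0) :
    0 ≤ trR d (Vᴴ * L X * V) := by
  have h1 := (((endExp_deriv L X).const_mul Vᴴ).mul_const V).hasDerivWithinAt (s := Set.Ioi 0)
  have h2 := (trR d).hasFDerivAt.comp_hasDerivWithinAt (0 : ℝ) h1
  rw [hasDerivWithinAt_iff_tendsto_slope' Set.self_notMem_Ioi] at h2
  refine ge_of_tendsto h2 ?_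
  filter_upwards [self_mem_nhdsWithin] with t ht
  have ht0 : 0 ≤ t := le_of_lt ht
  rw [slope_def_field]
  have e : trR d (Vᴴ * endExp L 0 X * V) = 0 := by
    rw [endExp_zero, mul_assoc, hXV, mul_zero, map_zero]
  simp only [Function.comp]
  rw [e, sub_zero, sub_zero]
  apply div_nonneg _ ht0
  have h4 := (((hL t ht0).1 X hX).conjTranspose_mul_mul_same V).trace_nonneg
  rw [Complex.le_def] at h4
  exact h4.1

theorem QLQ {d : ℕ} [NeZero d] {L : Mat d →ₗ[ℂ] Mat d}
    (hL : ∀ t : ℝ, 0 ≤ t → IsPTP (endExp L t)) {φ Q Y : Mat d} (h : KP φ Q) (hφ : Q * L φ = 0) (hY : Y.IsHermitian)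
    (hQY : Q * Y = 0) : Q * L Y * Q = 0 := by
  obtain ⟨ε, hε, he⟩ := h.pert hY hQY
  have key : ∀ s : ℝ, |s| < ε → ∀ Z : Mat d, 0 ≤ s * trR d (Zᴴ * (Q * L Y * Q) * Z) := by
    intro s hs Z
    have hk := he s hs
    have := condpos hL (X := φ + s • Y) (V := Q * Z) hk.psd (by rw [← mul_assoc, hk.h4', zero_mul])
    have e : (Q * Z)ᴴ * L (φ + s • Y) * (Q * Z) = s • (Zᴴ * (Q * L Y * Q) * Z) := by
      rw [conjTranspose_mul, h.h2.eq, map_add, LinearMap.map_smul_of_tower]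
      calc _ = Zᴴ * (Q * L φ) * (Q * Z) + s • (Zᴴ * (Q * L Y * Q) * Z) := by
            simp only [mul_add, add_mul, mul_assoc, mul_smul_comm, smul_mul_assoc]
        _ = _ := by rw [hφ]; simp
    rwa [e, map_smul, smul_eq_mul] at this
  have key2 : ∀ Z : Mat d, trR d (Zᴴ * (Q * L Y * Q) * Z) = 0 := by
    intro Z
    have a1 := key (ε / 2) (by rw [abs_of_pos] <;> linarith) Z
    have a2 := key (-(ε / 2)) (by rw [abs_neg, abs_of_pos] <;> linarith) Z
    nlinarith
  set H := Q * L Y * Q with hH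
  have hHH : Hᴴ = H := by
    rw [hH, conjTranspose_mul, conjTranspose_mul, h.h2.eq, (L_herm hL hY).eq, mul_assoc]
  have b1 := key2 (1 + H)
  have b2 := key2 (1 - H)
  rw [conjTranspose_add, conjTranspose_one, hHH] at b1
  rw [conjTranspose_sub, conjTranspose_one, hHH] at b2
  have e : (1 + H) * H * (1 + H) - (1 - H) * H * (1 - H) = (4 : ℝ) • (H * H) := by
    have : (4 : ℝ) • (H * H) = H * H + H * H + H * H + H * H := by
      rw [show (4 : ℝ) = 1 + 1 + 1 + 1 by norm_num]; simp only [add_smul, one_smul]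
    rw [this]; noncomm_ring
  have c := congrArg (trR d) e
  rw [map_sub, b1, b2, map_smul, smul_eq_mul] at c
  apply trR_sq
  rw [hHH]; linarith

theorem dissip_id {d : ℕ} [NeZero d] {L : Mat d →ₗ[ℂ] Mat d}
    (hL : ∀ t : ℝ, 0 ≤ t → IsPTP (endExp L t)) {X Q N : Mat d} (hX : X.PosSemidef) (hQ : Q.IsHermitian) (hQX : Q * X = 0)
    (h0 : Q * L X * Q = 0) (hQN : Q * N = 0) (hNQ : N * Q = N) :
    2 * trR d (Q * L X * N) = trR d (Q * L (X * N + Nᴴ * X) * Q) := by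
  have hXQ : X * Q = 0 := by
    have := congrArg conjTranspose hQX
    rwa [conjTranspose_mul, hX.isHermitian.eq, hQ.eq, conjTranspose_zero] at this
  have hNN : N * N = 0 := by
    calc N * N = N * Q * N := by rw [hNQ]
      _ = 0 := by rw [mul_assoc, hQN, mul_zero]
  let T : ℝ → Mat d := fun ε => Q + ε • N
  let S : ℝ → Mat d := fun ε => 1 - ε • N
  let Lc : Mat d →L[ℝ] Mat d := LinearMap.toContinuousLinearMap (L.restrictScalars ℝ)
  have hT : HasDerivAt T N 0 := by
    simpa [T] using ((hasDerivAt_id (0 : ℝ)).smul_const N).const_add Q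
  have hS : HasDerivAt S (-N) 0 := by
    simpa [S] using ((hasDerivAt_id (0 : ℝ)).smul_const N).const_sub 1
  have hM := (Lc.hasFDerivAt.comp_hasDerivAt (0 : ℝ) ((hS.star.mul_const X).mul hS))
  have hg := (trR d).hasFDerivAt.comp_hasDerivAt (0 : ℝ) ((hT.star.mul hM).mul hT)
  have hmin : IsLocalMin ((trR d) ∘ ((star T * (Lc ∘ ((fun y => star S y * X) * S))) * T)) 0 := by
    refine Filter.Eventually.of_forall fun ε => ?_
    have e0 : ((trR d) ∘ ((star T * (Lc ∘ ((fun y => star S y * X) * S))) * T)) 0 = 0 := by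
      have : star Q * L X * Q = 0 := by rw [star_eq_conjTranspose, hQ.eq]; exact h0
      simp [T, S, Lc, this]
    rw [e0]
    have hp := hX.conjTranspose_mul_mul_same (S ε)
    refine condpos hL (X := (S ε)ᴴ * X * S ε) (V := T ε) hp ?_
    have : S ε * T ε = Q := by
      simp only [S, T, sub_mul, mul_add, one_mul, smul_mul_assoc, mul_smul_comm, hNN, hNQ]
      simp
    rw [mul_assoc, this, mul_assoc, hXQ, mul_zero]
  have h1 := hmin.hasDerivAt_eq_zero hg
  have hLc : ∀ Z, Lc Z = L Z := fun _ => rfl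
  simp only [T, S, hLc, Function.comp, Pi.mul_apply, conjTranspose_one, zero_smul, add_zero, sub_zero, star_one,
    one_mul, mul_one, star_neg, star_eq_conjTranspose, hQ.eq, map_add, map_neg, add_mul, mul_add, neg_mul, mul_neg] at h1

  have e2 : trR d (Nᴴ * L X * Q) = trR d (Q * L X * N) := by
    rw [← trR_star, conjTranspose_mul, conjTranspose_mul, (L_herm hL hX.isHermitian).eq, hQ.eq,
      conjTranspose_conjTranspose, mul_assoc]
  simp only [map_add, mul_add, add_mul]
  linarith

theorem QL_zero {d : ℕ} [NeZero d] {L : Mat d →ₗ[ℂ] Mat d}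
    (hL : ∀ t : ℝ, 0 ≤ t → IsPTP (endExp L t)) {φ Q Y : Mat d} (h : KP φ Q) (hφ : Q * L φ = 0) (hY : Y.IsHermitian)
    (hQY : Q * Y = 0) : Q * L Y = 0 := by
  obtain ⟨ε, hε, he⟩ := h.pert hY hQY
  have hk := he (ε / 2) (by rw [abs_of_pos] <;> linarith)
  set X := φ + (ε / 2) • Y with hXdef
  have hQLXQ : Q * L X * Q = 0 := by
    rw [hXdef, map_add, LinearMap.map_smul_of_tower, mul_add, hφ, mul_smul_comm, zero_add,
      smul_mul_assoc, QLQ hL h hφ hY hQY, smul_zero]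
  obtain ⟨u, hu⟩ := h.h5.isUnit
  have e1 : (φ + Q) * (↑u⁻¹ : Mat d) = 1 := by rw [← hu]; simp
  have e2 : Q * (↑u⁻¹ : Mat d) = Q := by
    have : Q * ((φ + Q) * (↑u⁻¹ : Mat d)) = Q := by rw [e1, mul_one]
    rwa [← mul_assoc, mul_add, h.h4, h.h3, zero_add] at this
  have step : ∀ N' : Mat d, Q * N' = 0 → N' * Q = N' → trR d (Q * L (N' + N'ᴴ) * Q) = 0 := by
    intro N' h1 h2
    have a1 : Q * ((↑u⁻¹ : Mat d) * N') = 0 := by rw [← mul_assoc, e2, h1]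
    have a2 : ((↑u⁻¹ : Mat d) * N') * Q = (↑u⁻¹ : Mat d) * N' := by rw [mul_assoc, h2]
    have a3 : φ * ((↑u⁻¹ : Mat d) * N') = N' := by
      have : (φ + Q) * ((↑u⁻¹ : Mat d) * N') = N' := by rw [← mul_assoc, e1, one_mul]
      rwa [add_mul, a1, add_zero] at this
    have := dissip_id hL h.psd h.h2 h.h4 (by rw [hφ, zero_mul]) a1 a2
    have a4 : ((↑u⁻¹ : Mat d) * N')ᴴ * φ = N'ᴴ := by
      rw [← congrArg conjTranspose a3, conjTranspose_mul φ, h.h1.eq]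
    rw [a3, a4, hφ, zero_mul, map_zero, mul_zero] at this
    exact this.symm
  set K := Q * L X * (1 - Q) with hK
  have hN1 : Q * ((1 - Q) * Kᴴ) = 0 := by
    rw [← mul_assoc, mul_sub, mul_one, h.h3, sub_self, zero_mul]
  have hN2 : ((1 - Q) * Kᴴ) * Q = (1 - Q) * Kᴴ := by
    rw [hK, conjTranspose_mul, conjTranspose_mul, h.h2.eq]
    simp only [mul_assoc, h.h3]
  have f1 := dissip_id hL hk.psd h.h2 hk.h4 hQLXQ hN1 hN2
  have f2 := step (X * ((1 - Q) * Kᴴ)) (by rw [← mul_assoc, hk.h4, zero_mul]) (by rw [mul_assoc, hN2])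
  rw [conjTranspose_mul X, hk.h1.eq] at f2
  rw [f2, ← mul_assoc, ← hK] at f1
  have f3 : K = 0 := by
    have : Kᴴ = 0 := by
      apply trR_sq
      rw [conjTranspose_conjTranspose]; linarith
    simpa using this
  have f4 : Q * L X = 0 := by
    have : Q * L X = K + Q * L X * Q := by rw [hK]; noncomm_ring
    rw [this, f3, hQLXQ, add_zero]
  rw [hXdef, map_add, LinearMap.map_smul_of_tower, mul_add, hφ, mul_smul_comm, zero_add] at f4
  exact (smul_eq_zero.1 f4).resolve_left (by positivity)

theorem invar {d : ℕ} [NeZero d] {L : Mat d →ₗ[ℂ] Mat d}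
    (hL : ∀ t : ℝ, 0 ≤ t → IsPTP (endExp L t)) {φ Q Y : Mat d} (h : KP φ Q) (hφ : Q * L φ = 0) (hY : Y.IsHermitian)
    (hQY : Q * Y = 0) (t : ℝ) : Q * endExp L t Y = 0 := by
  have h1 : ∀ n : ℕ, ((L ^ n) Y).IsHermitian ∧ Q * (L ^ n) Y = 0 := by
    intro n
    induction n with
    | zero => exact ⟨by simpa using hY, by simpa using hQY⟩
    | succ n ih =>
      rw [pow_succ', Module.End.mul_apply]
      exact ⟨L_herm hL ih.1, QL_zero hL h hφ ih.1 ih.2⟩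
  have h2 := (endExp_hasSum L t Y).mul_left Q
  refine h2.unique ?_
  convert hasSum_zero with n
  rw [mul_smul_comm, (h1 n).2, smul_zero]

end aux2

section aux3
open scoped Matrix.Norms.L2Operator MatrixOrder
open Filter Topology

theorem log_curve {d : ℕ} [NeZero d] {Q B0 : Mat d} (hQ : Q.IsHermitian) (hQQ : Q * Q = Q)
    (hn : ‖1 - (B0 + Q)‖ < 1) : ∃ D : Mat d →L[ℝ] Mat d,
    (∀ X Y, trR d (X * D Y) = trR d (Y * D X)) ∧
    (∀ Y, Commute B0 Y → Commute Q Y → (B0 + Q) * D Y = Y) ∧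
    ∀ (B C : ℝ → Mat d) (B' C' : Mat d) (s : Set ℝ) (t0 : ℝ), B t0 = B0 → t0 ∈ s →
      HasDerivWithinAt B B' s t0 → HasDerivWithinAt C C' s t0 →
      (∀ᶠ t in 𝓝[s] t0, (B t).IsHermitian ∧ Q * B t = 0) →
      HasDerivWithinAt (fun t => trR d (C t * matLog (B t)))
        (trR d (C' * matLog B0) + trR d (C t0 * D B')) s t0 := by
  haveI : NormOneClass (Mat d) := ⟨CStarRing.norm_one⟩
  obtain ⟨D, h1, h2, h3⟩ := logser (1 - (B0 + Q)) hn
  refine ⟨D, h2 (trR d) trR_comm, ?_, ?_⟩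
  · intro Y hY hY2
    have := h3 Y ((Commute.one_left Y).sub_left (hY.add_left hY2))
    rwa [sub_sub_cancel] at this
  · intro B C B' C' s t0 hB0 ht0 hB hC hev
    set g : Mat d → Mat d := fun x => ∑' n : ℕ, ((n + 1 : ℝ)⁻¹) • x ^ (n + 1) with hg
    have hA : HasDerivWithinAt (fun t => 1 - (B t + Q)) (-B') s t0 :=
      (hB.add_const Q).const_sub 1
    have hcont := hA.continuousWithinAt
    have hlt : ∀ᶠ t in 𝓝[s] t0, ‖1 - (B t + Q)‖ < 1 := by
      have := hcont.norm
      refine this.eventually (gt_mem_nhds ?_)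
      show ‖1 - (B t0 + Q)‖ < 1
      rw [hB0]; exact hn
    have hev2 : ∀ᶠ t in 𝓝[s] t0, matLog (B t) = - g (1 - (B t + Q)) := by
      filter_upwards [hev, hlt] with t a b
      exact matLog_eq a.1 hQ hQQ a.2 b
    have h0 := hev2.self_of_nhdsWithin ht0
    have h1' : HasFDerivAt g D (1 - (B t0 + Q)) := by rw [hB0]; exact h1
    have hlog : HasDerivWithinAt (fun t => matLog (B t)) (D B') s t0 := by
      have h4 := (h1'.comp_hasDerivWithinAt t0 hA).neg
      have h5 : HasDerivWithinAt (fun t => - g (1 - (B t + Q))) (D B') s t0 :=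
        h4.congr_deriv (by rw [map_neg, neg_neg])
      exact h5.congr_of_eventuallyEq hev2 h0
    have h6 := (trR d).hasFDerivAt.comp_hasDerivWithinAt t0 (hC.mul hlog)
    rw [map_add, hB0] at h6
    exact h6

theorem kp_lt {d : ℕ} [NeZero d] {B : ℝ → Mat d} {B' Q : Mat d} (hB : HasDerivAt B B' 0)
    (h0 : ‖1 - (B 0 + Q)‖ < 1) : ∃ ε : ℝ, 0 < ε ∧ ∀ t : ℝ, |t| < ε → ‖1 - (B t + Q)‖ < 1 := by
  have hA : HasDerivAt (fun t => 1 - (B t + Q)) (-B') 0 := (hB.add_const Q).const_sub 1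
  have h := hA.continuousAt.norm.eventually (gt_mem_nhds h0)
  rw [Metric.eventually_nhds_iff] at h
  obtain ⟨ε, hε, h⟩ := h
  refine ⟨ε, hε, fun t ht => h ?_⟩
  simpa [Real.dist_eq] using ht

theorem vN_eq {d : ℕ} (ρ : Mat d) : vN ρ = - trR d (ρ * matLog ρ) := rfl

theorem D_self {d : ℕ} {ω Q : Mat d} (hk : KP ω Q) {D : Mat d →L[ℝ] Mat d}
    (h2 : ∀ Y, Commute ω Y → Commute Q Y → (ω + Q) * D Y = Y) : D ω = 1 - Q := by
  have h : (ω + Q) * D ω = ω :=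
    h2 ω (Commute.refl _) (show Q * ω = ω * Q by rw [hk.h4, hk.h4'])
  have h' : (ω + Q) * (1 - Q) = ω := by
    rw [mul_sub, mul_one, add_mul, hk.h4', hk.h3]; simp
  exact hk.h5.isUnit.mul_left_cancel (h.trans h'.symm)

theorem tr_self {d : ℕ} [NeZero d] {L : Mat d →ₗ[ℂ] Mat d}
    (hL : ∀ t : ℝ, 0 ≤ t → IsPTP (endExp L t)) {ω Q : Mat d} (hk : KP ω Q)
    (hQL : Q * L ω = 0) {D : Mat d →L[ℝ] Mat d}
    (h2 : ∀ Y, Commute ω Y → Commute Q Y → (ω + Q) * D Y = Y) :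
    trR d (L ω * D ω) = 0 := by
  rw [D_self hk h2, mul_sub, mul_one, map_sub, L_trace hL, trR_comm, hQL, map_zero, sub_zero]

theorem vN_deriv {d : ℕ} [NeZero d] {L : Mat d →ₗ[ℂ] Mat d}
    (hL : ∀ t : ℝ, 0 ≤ t → IsPTP (endExp L t)) {ω Q : Mat d} (hk : KP ω Q) (hd : IsDensity ω)
    (hQL : Q * L ω = 0) :
    HasDerivWithinAt (fun t : ℝ => vN (endExp L t ω)) (- trR d (L ω * matLog ω)) (Set.Ici 0) 0 := by
  obtain ⟨D, h1, h2, h3⟩ := log_curve hk.h2 hk.h3 (kp_norm hk hd)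
  have hder := (endExp_deriv L ω).hasDerivWithinAt (s := Set.Ici 0)
  have h4 := h3 _ _ _ _ (Set.Ici 0) 0 (endExp_zero L ω) Set.self_mem_Ici hder hder (by
    filter_upwards [self_mem_nhdsWithin] with t ht
    exact ⟨endExp_herm hL hk.h1 ht, invar hL hk hQL hk.h1 hk.h4 t⟩)
  rw [endExp_zero, h1, tr_self hL hk hQL h2, add_zero] at h4
  exact h4.neg

theorem EPrate_eq {d : ℕ} [NeZero d] {L : Mat d →ₗ[ℂ] Mat d}
    (hL : ∀ t : ℝ, 0 ≤ t → IsPTP (endExp L t)) (Qd : Mat d →ₗ[ℝ] ℝ) {ω Q : Mat d}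
    (hk : KP ω Q) (hd : IsDensity ω) (hQL : Q * L ω = 0) :
    EPrate L Qd ω = - trR d (L ω * matLog ω) + Qd ω := by
  rw [EPrate, (vN_deriv hL hk hd hQL).derivWithin (uniqueDiffWithinAt_Ici 0)]

theorem stationary {d : ℕ} [NeZero d] {L : Mat d →ₗ[ℂ] Mat d}
    (hL : ∀ t : ℝ, 0 ≤ t → IsPTP (endExp L t)) (Qd : Mat d →ₗ[ℝ] ℝ) (P : Finset (Mat d))
    {φ ρ Q : Mat d} (hφ : φ ∈ DP P) (hρ : ρ ∈ DP P) (hk : KP φ Q) (hQφ : Q * L φ = 0)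
    (hQρ : Q * ρ = 0)
    (hmin : ∀ ω ∈ DP P, SuppLE (L ω) ω → EPrate L Qd φ ≤ EPrate L Qd ω)
    {D : Mat d →L[ℝ] Mat d}
    (h3 : ∀ (B C : ℝ → Mat d) (B' C' : Mat d) (s : Set ℝ) (t0 : ℝ), B t0 = φ → t0 ∈ s →
      HasDerivWithinAt B B' s t0 → HasDerivWithinAt C C' s t0 →
      (∀ᶠ t in 𝓝[s] t0, (B t).IsHermitian ∧ Q * B t = 0) →
      HasDerivWithinAt (fun t => trR d (C t * matLog (B t)))
        (trR d (C' * matLog φ) + trR d (C t0 * D B')) s t0) :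
    - (trR d (L (ρ - φ) * matLog φ) + trR d (L φ * D (ρ - φ))) + Qd (ρ - φ) = 0 := by
  set δ := ρ - φ with hδ
  have hδH : δ.IsHermitian := hρ.1.1.isHermitian.sub hk.h1
  have hQδ : Q * δ = 0 := by rw [hδ, mul_sub, hQρ, hk.h4, sub_zero]
  obtain ⟨ε, hε, he⟩ := hk.pert hδH hQδ
  have hW : HasDerivAt (fun s : ℝ => φ + s • δ) δ 0 := by
    simpa using ((hasDerivAt_id (0 : ℝ)).smul_const δ).const_add φ
  let Lc : Mat d →L[ℝ] Mat d := LinearMap.toContinuousLinearMap (L.restrictScalars ℝ)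
  let Qc : Mat d →L[ℝ] ℝ := LinearMap.toContinuousLinearMap Qd
  have hLW : HasDerivAt (fun s : ℝ => L (φ + s • δ)) (L δ) 0 :=
    Lc.hasFDerivAt.comp_hasDerivAt (0 : ℝ) hW
  have hQW : HasDerivAt (fun s : ℝ => Qd (φ + s • δ)) (Qd δ) 0 :=
    Qc.hasFDerivAt.comp_hasDerivAt (0 : ℝ) hW
  have hball : ∀ᶠ s : ℝ in 𝓝 0, |s| < ε := by
    have : Metric.ball (0 : ℝ) ε ∈ 𝓝 (0 : ℝ) := Metric.ball_mem_nhds _ hε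
    filter_upwards [this] with s hs
    simpa [Real.dist_eq] using hs
  have h5 := h3 _ _ _ _ Set.univ 0 (by simp) (Set.mem_univ _)
    hW.hasDerivWithinAt hLW.hasDerivWithinAt (by
      rw [nhdsWithin_univ]
      filter_upwards [hball] with s hs
      exact ⟨(he s hs).h1, (he s hs).h4⟩)
  rw [hasDerivWithinAt_univ] at h5
  have h6 := h5.neg.add hQW
  have hd : ∀ s : ℝ, |s| < ε → EPrate L Qd (φ + s • δ) =
      - trR d (L (φ + s • δ) * matLog (φ + s • δ)) + Qd (φ + s • δ) ∧
      EPrate L Qd φ ≤ EPrate L Qd (φ + s • δ) := by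
    intro s hs
    have hks := he s hs
    have hden : IsDensity (φ + s • δ) := by
      refine ⟨hks.psd, ?_⟩
      rw [trace_add, trace_smul, hδ, trace_sub, hφ.1.2, hρ.1.2]; simp
    have hQL : Q * L (φ + s • δ) = 0 := QL_zero hL hk hQφ hks.h1 hks.h4
    refine ⟨EPrate_eq hL Qd hks hden hQL, hmin _ ⟨hden, ?_⟩ ?_⟩
    · have a : δ = ∑ pr ∈ P, pr * δ * pr := by
        have a1 := hφ.2
        have a2 := hρ.2
        rw [hδ]
        conv_lhs => rw [a1, a2]
        rw [← Finset.sum_sub_distrib]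
        exact Finset.sum_congr rfl fun p _ => by rw [mul_sub, sub_mul]
      conv_lhs => rw [a, hφ.2]
      rw [Finset.smul_sum, ← Finset.sum_add_distrib]
      exact Finset.sum_congr rfl fun p _ => by
        rw [mul_add, add_mul, mul_smul_comm, smul_mul_assoc]
    · exact suppLE_of hks.h5.isUnit hks.h3 hks.h4 hQL
  have hloc : IsLocalMin (fun s : ℝ => - trR d (L (φ + s • δ) * matLog (φ + s • δ))
      + Qd (φ + s • δ)) 0 := by
    filter_upwards [hball] with s hs
    have a := hd s hs
    have b := hd 0 (by simpa using hε)
    rw [← a.1, ← b.1]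
    simpa using a.2
  have h7 := hloc.hasDerivAt_eq_zero h6
  simpa using h7

theorem main_aux {d : ℕ} [NeZero d] (L : Mat d →ₗ[ℂ] Mat d)
    (hL : ∀ t : ℝ, 0 ≤ t → IsPTP (endExp L t)) (Qd : Mat d →ₗ[ℝ] ℝ) (P : Finset (Mat d))
    (φ : Mat d) (hφ : φ ∈ DP P) (hLφ : SuppLE (L φ) φ)
    (hmin : ∀ ω ∈ DP P, SuppLE (L ω) ω → EPrate L Qd φ ≤ EPrate L Qd ω)
    (ρ : Mat d) (hρ : ρ ∈ DP P) (hsupp : SuppLE ρ φ) (hLρ : SuppLE (L ρ) ρ) :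
    DifferentiableWithinAt ℝ (fun t : ℝ => vN (endExp L t ρ)) (Set.Ici 0) 0 ∧
    DifferentiableWithinAt ℝ (fun t : ℝ => vN (endExp L t φ)) (Set.Ici 0) 0 ∧
    (∃ ε : ℝ, 0 < ε ∧ ∀ t ∈ Set.Ico (0 : ℝ) ε, SuppLE (endExp L t ρ) (endExp L t φ)) ∧
    HasDerivWithinAt (fun t : ℝ => qRelEnt (endExp L t ρ) (endExp L t φ))
      (-(EPrate L Qd ρ - EPrate L Qd φ)) (Set.Ici 0) 0 := by
  haveI : NormOneClass (Mat d) := ⟨CStarRing.norm_one⟩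
  obtain ⟨Q, hk⟩ := kp_exists hφ.1.1
  obtain ⟨Qr, hkr⟩ := kp_exists hρ.1.1
  have hQφ := suppLE_imp hk.h4 hLφ
  have hQρ := suppLE_imp hk.h4 hsupp
  have hQr := suppLE_imp hkr.h4 hLρ
  have v1 := vN_deriv hL hkr hρ.1 hQr
  have v2 := vN_deriv hL hk hφ.1 hQφ
  have hn := kp_norm hk hφ.1
  refine ⟨v1.differentiableWithinAt, v2.differentiableWithinAt, ?_, ?_⟩
  · obtain ⟨ε, hε, he⟩ := kp_lt (Q := Q) (endExp_deriv L φ) (by rw [endExp_zero]; exact hn)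
    refine ⟨ε, hε, fun t ht => ?_⟩
    have a := he t (by rw [abs_of_nonneg ht.1]; exact ht.2)
    have hu : IsUnit (endExp L t φ + Q) := by
      have := isUnit_one_sub_of_norm_lt_one a
      rwa [sub_sub_cancel] at this
    exact suppLE_of hu hk.h3 (invar hL hk hQφ hk.h1 hk.h4 t)
      (invar hL hk hQφ hkr.h1 hQρ t)
  · obtain ⟨D, h1, h2, h3⟩ := log_curve hk.h2 hk.h3 hn
    have st := stationary hL Qd P hφ hρ hk hQφ hQρ hmin h3
    have z := tr_self hL hk hQφ h2
    have b := h3 _ _ _ _ (Set.Ici 0) 0 (endExp_zero L φ) Set.self_mem_Ici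
      (endExp_deriv L φ).hasDerivWithinAt (endExp_deriv L ρ).hasDerivWithinAt (by
        filter_upwards [self_mem_nhdsWithin] with t ht
        exact ⟨endExp_herm hL hk.h1 ht, invar hL hk hQφ hk.h1 hk.h4 t⟩)
    rw [endExp_zero, h1 ρ] at b
    have c := v1.neg.sub b
    rw [EPrate_eq hL Qd hkr hρ.1 hQr, EPrate_eq hL Qd hk hφ.1 hQφ]
    simp only [map_sub, sub_mul, mul_sub] at st
    have e : (fun t : ℝ => qRelEnt (endExp L t ρ) (endExp L t φ)) =
        fun t : ℝ => - vN (endExp L t ρ) - trR d (endExp L t ρ * matLog (endExp L t φ)) := by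
      funext t
      rw [vN_eq, neg_neg, ← map_sub, ← mul_sub]
      rfl
    rw [e]
    refine c.congr_deriv ?_
    linarith
end aux3

/-- Mismatch cost for the instantaneous EP rate: if `φ` minimizes the EP rate within `D_P`
(among states where it is well defined), then for `ρ ∈ D_P` with `supp ρ ⊆ supp φ` and
`supp L(ρ) ⊆ supp ρ`, the EP rates at `ρ` and `φ` are well defined and
`Σ̇(ρ) − Σ̇(φ) = −(d/dt)|_{t=0⁺} S(exp(tL)ρ ‖ exp(tL)φ)`, the relative entropy being finite
for all small `t ≥ 0` since `supp(exp(tL)ρ) ⊆ supp(exp(tL)φ)`. -/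
theorem mismatch_cost_EP_rate {d : ℕ} (hd : 1 ≤ d)
    (L : Matrix (Fin d) (Fin d) ℂ →ₗ[ℂ] Matrix (Fin d) (Fin d) ℂ)
    (hL : ∀ t : ℝ, 0 ≤ t → IsPTP (endExp L t))
    (Qd : Matrix (Fin d) (Fin d) ℂ →ₗ[ℝ] ℝ)
    (P : Finset (Matrix (Fin d) (Fin d) ℂ)) (hP : IsOrthProjFamily P)
    (φ : Matrix (Fin d) (Fin d) ℂ) (hφ : φ ∈ DP P) (hLφ : SuppLE (L φ) φ)
    (hmin : ∀ ω ∈ DP P, SuppLE (L ω) ω → EPrate L Qd φ ≤ EPrate L Qd ω)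
    (ρ : Matrix (Fin d) (Fin d) ℂ) (hρ : ρ ∈ DP P)
    (hsupp : SuppLE ρ φ) (hLρ : SuppLE (L ρ) ρ) :
    DifferentiableWithinAt ℝ (fun t : ℝ => vN (endExp L t ρ)) (Set.Ici 0) 0 ∧
    DifferentiableWithinAt ℝ (fun t : ℝ => vN (endExp L t φ)) (Set.Ici 0) 0 ∧
    (∃ ε : ℝ, 0 < ε ∧ ∀ t ∈ Set.Ico (0 : ℝ) ε, SuppLE (endExp L t ρ) (endExp L t φ)) ∧
    HasDerivWithinAt (fun t : ℝ => qRelEnt (endExp L t ρ) (endExp L t φ))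
      (-(EPrate L Qd ρ - EPrate L Qd φ)) (Set.Ici 0) 0 := by
  haveI : NeZero d := ⟨by omega⟩
  exact main_aux L hL Qd P φ hφ hLφ hmin ρ hρ hsupp hLρ
end

section
/- Fix a finite state space X, a stochastic matrix T, a linear functional G on ℝ^X, and the classical EP-type function Σ(p) = H(Tp) − H(p) + G(p). Let r be a probability distribution on X with Σ(r) ≤ Σ(q) for every probability distribution q on X, and let p be a probability distribution with supp p ⊆ supp r. Then supp Tp ⊆ supp Tr and Σ(p) − Σ(r) = D(p‖r) − D(Tp‖Tr). -/
open Finset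

variable {X : Type*}

/-- A probability distribution on the finite state space `X`. -/
def IsProb [Fintype X] (p : X → ℝ) : Prop :=
  (∀ i, 0 ≤ p i) ∧ ∑ i, p i = 1

/-- A (column-)stochastic matrix: `T j i = T(j|i) ≥ 0` and `∑_j T(j|i) = 1`. -/
def IsStoch [Fintype X] (T : X → X → ℝ) : Prop :=
  (∀ i j, 0 ≤ T j i) ∧ ∀ i, ∑ j, T j i = 1

/-- The action of a stochastic matrix: `(Tp)_j = ∑_i T(j|i) p_i`. -/
def stApply [Fintype X] (T : X → X → ℝ) (p : X → ℝ) : X → ℝ :=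
  fun j => ∑ i, T j i * p i

/-- Shannon entropy `H(p) = −∑ p_i ln p_i`, with the convention `0 ln 0 = 0`. -/
noncomputable def shEnt [Fintype X] (p : X → ℝ) : ℝ :=
  -∑ i, p i * Real.log (p i)

/-- Kullback–Leibler divergence `D(p‖r) = ∑_{i : p_i > 0} p_i ln (p_i / r_i)`. -/
noncomputable def KL [Fintype X] (p r : X → ℝ) : ℝ :=
  ∑ i, p i * Real.log (p i / r i)

/-- The classical EP-type function `Σ(p) = H(Tp) − H(p) + G(p)`. -/
noncomputable def clEP [Fintype X] (T : X → X → ℝ) (G : (X → ℝ) →ₗ[ℝ] ℝ) (p : X → ℝ) : ℝ :=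
  shEnt (stApply T p) - shEnt p + G p

theorem aux_hasDeriv (a b : ℝ) (ha : 0 ≤ a) (h : a = 0 → b = 0) :
    HasDerivAt (fun t : ℝ => (a + t * (b - a)) * Real.log (a + t * (b - a)))
      ((b - a) * (Real.log a + 1)) 0 := by
  rcases ha.eq_or_lt with h0 | h0
  · subst h0
    have hb := h rfl
    subst hb
    simpa using hasDerivAt_const (0 : ℝ) (0 : ℝ)
  · have h1 : HasDerivAt (fun t : ℝ => a + t * (b - a)) (b - a) 0 := by
      simpa using ((hasDerivAt_id (0 : ℝ)).mul_const (b - a)).const_add a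
    have h2 : HasDerivAt (fun x : ℝ => x * Real.log x) (Real.log a + 1)
        ((fun t : ℝ => a + t * (b - a)) 0) := by
      simpa using Real.hasDerivAt_mul_log h0.ne'
    have h3 := h2.comp (0 : ℝ) h1
    rw [mul_comm]
    exact h3

theorem aux_KL [Fintype X] (p r : X → ℝ) (h : ∀ i, r i = 0 → p i = 0) :
    KL p r = ∑ i, p i * Real.log (p i) - ∑ i, p i * Real.log (r i) := by
  unfold KL
  rw [← Finset.sum_sub_distrib]
  refine Finset.sum_congr rfl fun i _ => ?_
  by_cases hp : p i = 0
  · simp [hp]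
  · rw [Real.log_div hp (fun hr => hp (h i hr))]
    ring

theorem aux_sum [Fintype X] (T : X → X → ℝ) (hT : IsStoch T) (p : X → ℝ) :
    ∑ j, stApply T p j = ∑ i, p i := by
  unfold stApply
  rw [Finset.sum_comm]
  refine Finset.sum_congr rfl fun i _ => ?_
  rw [← Finset.sum_mul, hT.2 i, one_mul]

theorem aux_lin [Fintype X] (T : X → X → ℝ) (p r : X → ℝ) (t : ℝ) (j : X) :
    stApply T (r + t • (p - r)) j
      = stApply T r j + t * (stApply T p j - stApply T r j) := by
  unfold stApply
  rw [← Finset.sum_sub_distrib, Finset.mul_sum, ← Finset.sum_add_distrib]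
  refine Finset.sum_congr rfl fun i _ => ?_
  simp only [Pi.add_apply, Pi.smul_apply, Pi.sub_apply, smul_eq_mul]
  ring

/-- Classical mismatch cost: if `r` minimizes `Σ(p) = H(Tp) − H(p) + G(p)` over all probability
distributions and `supp p ⊆ supp r`, then `supp Tp ⊆ supp Tr` and
`Σ(p) − Σ(r) = D(p‖r) − D(Tp‖Tr)`. -/
theorem classical_mismatch_cost [Fintype X]
    (T : X → X → ℝ) (hT : IsStoch T) (G : (X → ℝ) →ₗ[ℝ] ℝ)
    (r : X → ℝ) (hr : IsProb r)
    (hmin : ∀ q : X → ℝ, IsProb q → clEP T G r ≤ clEP T G q)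
    (p : X → ℝ) (hp : IsProb p)
    (hsupp : ∀ i, 0 < p i → 0 < r i) :
    (∀ j, 0 < stApply T p j → 0 < stApply T r j) ∧
    clEP T G p - clEP T G r = KL p r - KL (stApply T p) (stApply T r) := by
  have hTr : ∀ j, 0 ≤ stApply T r j := fun j =>
    Finset.sum_nonneg fun i _ => mul_nonneg (hT.1 i j) (hr.1 i)
  have hTp : ∀ j, 0 ≤ stApply T p j := fun j =>
    Finset.sum_nonneg fun i _ => mul_nonneg (hT.1 i j) (hp.1 i)
  have h0 : ∀ i, r i = 0 → p i = 0 := by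
    intro i hi
    by_contra hne
    have := hsupp i (lt_of_le_of_ne (hp.1 i) (Ne.symm hne))
    linarith
  have hT0 : ∀ j, stApply T r j = 0 → stApply T p j = 0 := by
    intro j hj
    have h1 := (Finset.sum_eq_zero_iff_of_nonneg
      (fun i _ => mul_nonneg (hT.1 i j) (hr.1 i))).1 hj
    refine Finset.sum_eq_zero fun i hi => ?_
    rcases mul_eq_zero.1 (h1 i hi) with h | h
    · simp [h]
    · simp [h0 i h]
  refine ⟨fun j hj => lt_of_le_of_ne (hTr j) fun h => ?_, ?_⟩
  · exact hj.ne' (hT0 j h.symm)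
  have hev : ∀ᶠ t : ℝ in nhds 0, IsProb (r + t • (p - r)) := by
    have h1 : ∀ᶠ t : ℝ in nhds 0, ∀ i, 0 ≤ r i + t * (p i - r i) := by
      rw [Filter.eventually_all]
      intro i
      rcases (hr.1 i).eq_or_lt with h | h
      · simp [← h, h0 i h.symm]
      · have hc : Continuous fun t : ℝ => r i + t * (p i - r i) := by fun_prop
        have := (hc.tendsto 0).eventually_const_lt (u := 0) (by simpa using h)
        exact this.mono fun t ht => ht.le
    refine h1.mono fun t ht => ⟨fun i => by simpa using ht i, ?_⟩
    simp [Finset.sum_add_distrib, ← Finset.mul_sum, hr.2, hp.2]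
  have hloc : IsLocalMin (fun t : ℝ => clEP T G (r + t • (p - r))) 0 := by
    refine hev.mono fun t ht => ?_
    simpa using hmin _ ht
  have hder : HasDerivAt (fun t : ℝ => clEP T G (r + t • (p - r)))
      (-(∑ j, (stApply T p j - stApply T r j) * (Real.log (stApply T r j) + 1))
        - -(∑ i, (p i - r i) * (Real.log (r i) + 1)) + G (p - r)) 0 := by
    unfold clEP shEnt
    simp only [aux_lin, map_add, map_smul, Pi.add_apply, Pi.smul_apply, Pi.sub_apply, smul_eq_mul]
    refine ((HasDerivAt.fun_sum fun j _ => aux_hasDeriv _ _ (hTr j) (hT0 j)).fun_neg.fun_sub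
      (HasDerivAt.fun_sum fun i _ => aux_hasDeriv _ _ (hr.1 i) (h0 i)).fun_neg).fun_add ?_
    simpa using ((hasDerivAt_id (0 : ℝ)).mul_const (G (p - r))).const_add (G r)
  have hz := hloc.hasDerivAt_eq_zero hder
  have e1 := aux_sum T hT p
  have e2 := aux_sum T hT r
  rw [aux_KL p r h0, aux_KL _ _ hT0]
  unfold clEP shEnt
  simp only [mul_add, sub_mul, mul_one, Finset.sum_add_distrib, Finset.sum_sub_distrib,
    map_sub] at hz
  linarith
end

section
/- Fix a finite state space X, a stochastic matrix T, and probability distributions p, r on X with supp p ⊆ supp r; write p' = Tp, r' = Tr, and define γ = Σ_{j: r'_j > 0} p'_j · (Σ_{i: p_i > 0} T(j|i) r_i) / r'_j. Then: (i) the integral fluctuation theorem Σ_{(i,j): p_i T(j|i) > 0} p_i T(j|i) · exp(−[(ln p_i − ln r_i) − (ln p'_j − ln r'_j)]) = γ holds; (ii) 0 < γ ≤ 1; and (iii) if supp p = supp r then γ = 1. -/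
open Finset

variable {X : Type*}

/-- Integral fluctuation theorem for fluctuating mismatch cost: with
`γ = ∑_{j : r'_j > 0} p'_j (∑_{i : p_i > 0} T(j|i) r_i) / r'_j`, one has
(i) `⟨e^{−m}⟩ = γ`, (ii) `0 < γ ≤ 1`, and (iii) `γ = 1` whenever `supp p = supp r`. -/
theorem fluctuating_mismatch_IFT [Fintype X]
    (T : X → X → ℝ) (hT : IsStoch T)
    (p r : X → ℝ) (hp : IsProb p) (hr : IsProb r)
    (hsupp : ∀ i, 0 < p i → 0 < r i) :
    ∀ γ : ℝ,
      γ = ∑ j, (if 0 < stApply T r j then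
          stApply T p j * (∑ i, if 0 < p i then T j i * r i else 0) / stApply T r j
        else 0) →
      (∑ i, ∑ j, (if 0 < p i * T j i then
          p i * T j i *
            Real.exp (-((Real.log (p i) - Real.log (r i)) -
              (Real.log (stApply T p j) - Real.log (stApply T r j))))
        else 0)) = γ ∧
      (0 < γ ∧ γ ≤ 1) ∧
      ((∀ i, 0 < p i ↔ 0 < r i) → γ = 1) := by
  intro γ hγ
  obtain ⟨hT0, hT1⟩ := hT
  obtain ⟨hp0, hp1⟩ := hp
  obtain ⟨hr0, hr1⟩ := hr
  have hP0 : ∀ j, 0 ≤ stApply T p j := fun j =>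
    Finset.sum_nonneg fun i _ => mul_nonneg (hT0 i j) (hp0 i)
  have hpos : ∀ q : X → ℝ, (∀ i, 0 ≤ q i) → ∀ i j, 0 < T j i → 0 < q i →
      0 < stApply T q j := by
    intro q hq i j h1 h2
    exact Finset.sum_pos' (fun i _ => mul_nonneg (hT0 i j) (hq i))
      ⟨i, Finset.mem_univ i, mul_pos h1 h2⟩
  have hPR : ∀ j, 0 < stApply T p j → 0 < stApply T r j := by
    intro j hj
    obtain ⟨i, _, hi⟩ := Finset.exists_lt_of_sum_lt
      (s := Finset.univ) (f := fun _ : X => (0 : ℝ)) (g := fun i => T j i * p i)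
      (by simpa [stApply] using hj)
    have hpi : 0 < p i := lt_of_le_of_ne (hp0 i) (by rintro h; simp [← h] at hi)
    have hTi : 0 < T j i := lt_of_le_of_ne (hT0 i j) (by rintro h; simp [← h] at hi)
    exact hpos r hr0 i j hTi (hsupp i hpi)
  have hPsum : ∑ j, stApply T p j = 1 := by
    unfold stApply
    rw [Finset.sum_comm]
    simp_rw [← Finset.sum_mul, hT1, one_mul]
    exact hp1
  have hsplit : ∀ i j, 0 < p i * T j i → 0 < p i ∧ 0 < T j i := by
    intro i j h
    exact ⟨lt_of_le_of_ne (hp0 i) (by rintro h'; simp [← h'] at h),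
      lt_of_le_of_ne (hT0 i j) (by rintro h'; simp [← h'] at h)⟩
  have key : (∑ i, ∑ j, (if 0 < p i * T j i then
          p i * T j i *
            Real.exp (-((Real.log (p i) - Real.log (r i)) -
              (Real.log (stApply T p j) - Real.log (stApply T r j))))
        else 0)) = γ := by
    rw [hγ, Finset.sum_comm]
    refine Finset.sum_congr rfl fun j _ => ?_
    split_ifs with hj
    · rw [Finset.mul_sum, Finset.sum_div]
      refine Finset.sum_congr rfl fun i _ => ?_
      by_cases h : 0 < p i * T j i
      · obtain ⟨h1, h2⟩ := hsplit i j h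
        have h3 := hsupp i h1
        have h4 := hpos p hp0 i j h2 h1
        rw [if_pos h, if_pos h1]
        have : -((Real.log (p i) - Real.log (r i)) -
              (Real.log (stApply T p j) - Real.log (stApply T r j))) =
            (Real.log (r i) - Real.log (p i)) +
              (Real.log (stApply T p j) - Real.log (stApply T r j)) := by ring
        rw [this, Real.exp_add, Real.exp_sub, Real.exp_sub, Real.exp_log h1, Real.exp_log h3,
          Real.exp_log h4, Real.exp_log hj]
        field_simp
      · rw [if_neg h]
        split_ifs with h1
        · have : T j i = 0 := le_antisymm
            (not_lt.1 fun h2 => h (mul_pos h1 h2)) (hT0 i j)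
          simp [this]
        · simp
    · refine Finset.sum_eq_zero fun i _ => ?_
      rw [if_neg]
      intro h
      obtain ⟨h1, h2⟩ := hsplit i j h
      exact hj (hpos r hr0 i j h2 (hsupp i h1))
  refine ⟨key, ⟨?_, ?_⟩, ?_⟩
  · rw [← key]
    have hnn : ∀ i j, 0 ≤ (if 0 < p i * T j i then
          p i * T j i *
            Real.exp (-((Real.log (p i) - Real.log (r i)) -
              (Real.log (stApply T p j) - Real.log (stApply T r j))))
        else 0) := by
      intro i j
      split_ifs with h
      · exact (mul_pos h (Real.exp_pos _)).le
      · exact le_rfl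
    obtain ⟨i, _, hi⟩ := Finset.exists_lt_of_sum_lt
      (s := Finset.univ) (f := fun _ : X => (0 : ℝ)) (g := p) (by simp [hp1])
    obtain ⟨j, _, hj⟩ := Finset.exists_lt_of_sum_lt
      (s := Finset.univ) (f := fun _ : X => (0 : ℝ)) (g := fun j => T j i) (by simp [hT1])
    refine Finset.sum_pos' (fun i _ => Finset.sum_nonneg fun j _ => hnn i j)
      ⟨i, Finset.mem_univ i, Finset.sum_pos' (fun j _ => hnn i j) ⟨j, Finset.mem_univ j, ?_⟩⟩
    have h : 0 < p i * T j i := mul_pos hi hj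
    rw [if_pos h]
    exact mul_pos h (Real.exp_pos _)
  · rw [hγ, ← hPsum]
    refine Finset.sum_le_sum fun j _ => ?_
    split_ifs with hj
    · rw [div_le_iff₀ hj]
      refine mul_le_mul_of_nonneg_left (Finset.sum_le_sum fun i _ => ?_) (hP0 j)
      split_ifs
      · exact le_rfl
      · exact mul_nonneg (hT0 i j) (hr0 i)
    · exact hP0 j
  · intro hs
    rw [hγ, ← hPsum]
    refine Finset.sum_congr rfl fun j _ => ?_
    split_ifs with hj
    · have : (∑ i, if 0 < p i then T j i * r i else 0) = stApply T r j := by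
        refine Finset.sum_congr rfl fun i _ => ?_
        split_ifs with h
        · rfl
        · have : r i = 0 := le_antisymm (not_lt.1 fun h2 => h ((hs i).2 h2)) (hr0 i)
          simp [this]
      rw [this, mul_div_assoc, div_self hj.ne', mul_one]
    · exact le_antisymm (hP0 j) (not_lt.1 fun h => hj (hPR j h))
end

section
/- Fix a finite state space X, a stochastic matrix T, and probability distributions p, r on X with supp p ⊆ supp r; write p' = Tp, r' = Tr, m(i,j) = (ln p_i − ln r_i) − (ln p'_j − ln r'_j), and γ = Σ_{j: r'_j > 0} p'_j · (Σ_{i: p_i > 0} T(j|i) r_i) / r'_j. Then for every ξ ∈ ℝ, the probability of observing fluctuating mismatch cost at most −ξ is exponentially small: Σ_{(i,j): p_i T(j|i) > 0 and m(i,j) ≤ −ξ} p_i T(j|i) ≤ γ e^{−ξ}. -/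
open Finset

variable {X : Type*}

/-- Negative fluctuating mismatch cost is exponentially unlikely:
`Pr[m(i,j) ≤ −ξ] ≤ γ e^{−ξ}` for every `ξ ∈ ℝ`, where
`m(i,j) = (ln p_i − ln r_i) − (ln p'_j − ln r'_j)` and
`γ = ∑_{j : r'_j > 0} p'_j (∑_{i : p_i > 0} T(j|i) r_i) / r'_j`. -/
theorem fluctuating_mismatch_tail_bound [Fintype X]
    (T : X → X → ℝ) (hT : IsStoch T)
    (p r : X → ℝ) (hp : IsProb p) (hr : IsProb r)
    (hsupp : ∀ i, 0 < p i → 0 < r i) :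
    ∀ m : X → X → ℝ,
      (∀ i j, m i j = (Real.log (p i) - Real.log (r i)) -
          (Real.log (stApply T p j) - Real.log (stApply T r j))) →
      ∀ γ : ℝ,
        γ = ∑ j, (if 0 < stApply T r j then
            stApply T p j * (∑ i, if 0 < p i then T j i * r i else 0) / stApply T r j
          else 0) →
        ∀ ξ : ℝ,
          (∑ i, ∑ j, (if 0 < p i * T j i ∧ m i j ≤ -ξ then p i * T j i else 0)) ≤
            γ * Real.exp (-ξ) := by
  intro m hm γ hγ ξ
  have key : ∀ (q : X → ℝ), (∀ i, 0 ≤ q i) → ∀ i j, 0 < T j i → 0 < q i →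
      0 < stApply T q j := by
    intro q hq i j h1 h2
    exact Finset.sum_pos' (fun k _ => mul_nonneg (hT.1 k j) (hq k))
      ⟨i, Finset.mem_univ i, mul_pos h1 h2⟩
  have nn : ∀ (q : X → ℝ), (∀ i, 0 ≤ q i) → ∀ j, 0 ≤ stApply T q j := by
    intro q hq j
    exact Finset.sum_nonneg (fun k _ => mul_nonneg (hT.1 k j) (hq k))
  rw [hγ, Finset.sum_comm, Finset.sum_mul]
  refine Finset.sum_le_sum fun j _ => ?_
  have pos : ∀ i, 0 < p i * T j i → 0 < p i ∧ 0 < T j i := by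
    intro i h
    constructor
    · exact lt_of_le_of_ne (hp.1 i) (fun h0 => by rw [← h0] at h; simp at h)
    · exact lt_of_le_of_ne (hT.1 i j) (fun h0 => by rw [← h0] at h; simp at h)
  by_cases hj : 0 < stApply T r j
  · rw [if_pos hj, Finset.mul_sum, Finset.sum_div, Finset.sum_mul]
    refine Finset.sum_le_sum fun i _ => ?_
    by_cases hc : 0 < p i * T j i ∧ m i j ≤ -ξ
    · obtain ⟨h1, h2⟩ := pos i hc.1
      have h3 := hsupp i h1
      have h4 := key p hp.1 i j h2 h1
      rw [if_pos hc, if_pos h1]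
      have h5 : p i = Real.exp (m i j) * (stApply T p j * r i / stApply T r j) := by
        rw [hm, Real.exp_sub, Real.exp_sub, Real.exp_sub, Real.exp_log h1, Real.exp_log h3,
          Real.exp_log h4, Real.exp_log hj]
        field_simp
      have h6 : p i ≤ Real.exp (-ξ) * (stApply T p j * r i / stApply T r j) := by
        refine h5.le.trans ?_
        exact mul_le_mul_of_nonneg_right (Real.exp_le_exp.2 hc.2) (by positivity)
      calc p i * T j i ≤ Real.exp (-ξ) * (stApply T p j * r i / stApply T r j) * T j i :=
            mul_le_mul_of_nonneg_right h6 h2.le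
        _ = _ := by ring
    · rw [if_neg hc]
      have h7 : 0 ≤ (if 0 < p i then T j i * r i else 0) := by
        split_ifs
        · exact mul_nonneg (hT.1 i j) (hr.1 i)
        · exact le_rfl
      exact mul_nonneg (div_nonneg (mul_nonneg (nn p hp.1 j) h7) hj.le) (Real.exp_pos _).le
  · rw [if_neg hj, zero_mul]
    refine (Finset.sum_eq_zero fun i _ => ?_).le
    rw [if_neg]
    rintro ⟨h, -⟩
    obtain ⟨h1, h2⟩ := pos i h
    exact hj (key r hr.1 i j h2 (hsupp i h1))
end

section
/- Let Φ be a positive trace-preserving linear map on d×d complex matrices, Q a real-linear functional on Hermitian matrices, and Σ(ρ) = S(Φ(ρ)) − S(ρ) + Q(ρ). Let U be a unitary d×d matrix with U·U = I (involution) such that Φ(UXU†) = UΦ(X)U† for all X and Q(UρU†) = Q(ρ) for all density matrices ρ. For a density matrix ρ define Ψ(ρ) = (ρ + UρU†)/2. Then: (i) for every λ ∈ [0,1], Σ(λρ + (1−λ)UρU†) ≥ Σ(Ψ(ρ)); and (ii) Σ(ρ) − Σ(Ψ(ρ)) = S(ρ‖Ψ(ρ)) − S(Φ(ρ)‖Ψ(Φ(ρ))),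 where both relative entropies are finite since Ψ(ρ) ≥ ρ/2 and Ψ(Φ(ρ)) = Φ(Ψ(ρ)) ≥ Φ(ρ)/2. -/
open Matrix
open scoped ComplexOrder

open MeasureTheory Filter Topology

theorem spec_eq {d : ℕ} {A : Matrix (Fin d) (Fin d) ℂ} (hA : A.IsHermitian) :
    ∃ W : Matrix (Fin d) (Fin d) ℂ, Wᴴ * W = 1 ∧ W * Wᴴ = 1 ∧
      A = W * diagonal (fun i => (hA.eigenvalues i : ℂ)) * Wᴴ ∧
      matLog A = W * diagonal (fun i => (Real.log (hA.eigenvalues i) : ℂ)) * Wᴴ := by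
  refine ⟨hA.eigenvectorUnitary, ?_, ?_, ?_, ?_⟩
  · exact (Matrix.mem_unitaryGroup_iff').1 hA.eigenvectorUnitary.2
  · exact (Matrix.mem_unitaryGroup_iff).1 hA.eigenvectorUnitary.2
  · have := hA.spectral_theorem
    rw [Unitary.conjStarAlgAut_apply] at this
    exact this
  · rw [matLog, dif_pos hA]; rfl

theorem inertia_le {d : ℕ} {P : Matrix (Fin d) (Fin d) ℂ} {a b : Fin d → ℝ}
    (h : Pᴴ * diagonal (fun i => (a i : ℂ)) * P = diagonal (fun i => (b i : ℂ))) :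
    Fintype.card {i // b i < 0} ≤ Fintype.card {i // a i < 0} := by
  classical
  let ext : ({i // b i < 0} → ℂ) →ₗ[ℂ] (Fin d → ℂ) :=
    { toFun := fun v i => if hi : b i < 0 then v ⟨i, hi⟩ else 0
      map_add' := by intro v w; ext i; by_cases hi : b i < 0 <;> simp [hi]
      map_smul' := by intro c w; ext i; by_cases hi : b i < 0 <;> simp [hi] }
  let f : ({i // b i < 0} → ℂ) →ₗ[ℂ] ({i // a i < 0} → ℂ) :=
    (LinearMap.funLeft ℂ ℂ (fun i : {i // a i < 0} => (i : Fin d))) ∘ₗ P.mulVecLin ∘ₗ ext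
  have key : ∀ (c : Fin d → ℝ) (w : Fin d → ℂ),
      star w ⬝ᵥ (diagonal (fun i => (c i : ℂ)) *ᵥ w) = ((∑ i, c i * ‖w i‖ ^ 2 : ℝ) : ℂ) := by
    intro c w
    simp only [dotProduct, mulVec_diagonal, Pi.star_apply]
    push_cast
    refine Finset.sum_congr rfl fun i _ => ?_
    have := Complex.conj_mul' (w i)
    simp only [RCLike.star_def]
    rw [← this]; ring
  have hf : Function.Injective f := by
    rw [injective_iff_map_eq_zero]
    intro v hv
    have h1 : ∀ i, a i < 0 → (P *ᵥ ext v) i = 0 := by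
      intro i hi
      have := congrFun hv ⟨i, hi⟩
      simpa [f] using this
    have h2 := key b (ext v)
    rw [← h, ← mulVec_mulVec, ← mulVec_mulVec, dotProduct_mulVec, ← star_mulVec, key a] at h2
    have h3 : (∑ i, a i * ‖(P *ᵥ ext v) i‖ ^ 2 : ℝ) = ∑ i, b i * ‖ext v i‖ ^ 2 := by
      exact_mod_cast h2
    have h4 : 0 ≤ (∑ i, a i * ‖(P *ᵥ ext v) i‖ ^ 2 : ℝ) := by
      refine Finset.sum_nonneg fun i _ => ?_
      by_cases hi : a i < 0
      · simp [h1 i hi]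
      · have := not_lt.1 hi
        positivity
    have h5 : ∀ i ∈ Finset.univ, b i * ‖ext v i‖ ^ 2 ≤ 0 := by
      intro i _
      by_cases hi : b i < 0
      · exact mul_nonpos_of_nonpos_of_nonneg hi.le (by positivity)
      · simp [ext, hi]
    have h6 : ∑ i, b i * ‖ext v i‖ ^ 2 = 0 :=
      le_antisymm (Finset.sum_nonpos h5) (h3 ▸ h4)
    rw [Finset.sum_eq_zero_iff_of_nonpos h5] at h6
    ext ⟨i, hi⟩
    have := h6 i (Finset.mem_univ _)
    simp only [mul_eq_zero, hi.ne, false_or] at this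
    simpa [ext, hi] using this
  simpa using LinearMap.finrank_le_finrank_of_injective hf

theorem inertia_eq {d : ℕ} {A P R : Matrix (Fin d) (Fin d) ℂ} (hA : A.IsHermitian) (x : ℝ)
    (hPR : P * R = 1) {b : Fin d → ℝ}
    (h : Pᴴ * (A + (x : ℂ) • 1) * P = diagonal (fun i => (b i : ℂ))) :
    Fintype.card {i // b i < 0} = Fintype.card {i // hA.eigenvalues i + x < 0} := by
  obtain ⟨W, hW1, hW2, hW, -⟩ := spec_eq hA
  have hx : A + (x : ℂ) • 1 = W * diagonal (fun i => ((hA.eigenvalues i + x : ℝ) : ℂ)) * Wᴴ := by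
    have : diagonal (fun i => ((hA.eigenvalues i + x : ℝ) : ℂ)) =
        diagonal (fun i => ((hA.eigenvalues i : ℝ) : ℂ)) + (x : ℂ) • 1 := by
      ext i j; by_cases hij : i = j <;> simp [hij]
    rw [this, mul_add, add_mul, ← hW]
    simp [hW2]
  apply le_antisymm
  · apply inertia_le (P := Wᴴ * P)
    rw [← h, hx, conjTranspose_mul, conjTranspose_conjTranspose]
    simp only [mul_assoc]
  · apply inertia_le (P := R * W)
    rw [← h, conjTranspose_mul]
    have hRP : Rᴴ * Pᴴ = 1 := by rw [← conjTranspose_mul, hPR, conjTranspose_one]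
    calc Wᴴ * Rᴴ * (Pᴴ * (A + (x : ℂ) • 1) * P) * (R * W)
        = Wᴴ * (Rᴴ * Pᴴ) * (A + (x : ℂ) • 1) * (P * R) * W := by simp only [mul_assoc]
      _ = (Wᴴ * W) * diagonal (fun i => ((hA.eigenvalues i + x : ℝ) : ℂ)) * (Wᴴ * W) := by
          rw [hRP, hPR, hx]; simp only [mul_assoc, mul_one]
      _ = _ := by rw [hW1]; simp

theorem simul_diag {d : ℕ} {A D : Matrix (Fin d) (Fin d) ℂ} (hA : A.PosDef)
    (hD : D.IsHermitian) : ∃ (P R : Matrix (Fin d) (Fin d) ℂ) (μ : Fin d → ℝ), P * R = 1 ∧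
      Pᴴ * A * P = 1 ∧ Pᴴ * D * P = diagonal (fun i => (μ i : ℂ)) := by
  obtain ⟨W, hW1, hW2, hW, -⟩ := spec_eq hA.1
  have hpos := hA.eigenvalues_pos
  set lam := hA.1.eigenvalues
  let E : Matrix (Fin d) (Fin d) ℂ := diagonal (fun i => ((Real.sqrt (lam i))⁻¹ : ℂ))
  let E' : Matrix (Fin d) (Fin d) ℂ := diagonal (fun i => ((Real.sqrt (lam i)) : ℂ))
  have hs : ∀ i, ((Real.sqrt (lam i)) : ℂ) ≠ 0 := fun i => by
    have := (Real.sqrt_pos.2 (hpos i)).ne'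
    exact_mod_cast this
  have hE : E * E' = 1 := by
    simp only [E, E', diagonal_mul_diagonal]
    rw [← diagonal_one]; congr 1; ext i; exact inv_mul_cancel₀ (hs i)
  have hEE : Eᴴ = E := by
    simp only [E, diagonal_conjTranspose]; congr 1; ext i; simp
  have hElE : E * diagonal (fun i => (lam i : ℂ)) * E = 1 := by
    simp only [E, diagonal_mul_diagonal]
    rw [← diagonal_one]; congr 1; ext i
    have h1 : ((lam i : ℝ) : ℂ) = (Real.sqrt (lam i) : ℂ) * (Real.sqrt (lam i) : ℂ) := by
      exact_mod_cast (Real.mul_self_sqrt (hpos i).le).symm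
    rw [h1]; field_simp [hs i]
  have hM : ((W * E)ᴴ * D * (W * E)).IsHermitian := by
    have := Matrix.isHermitian_conjTranspose_mul_mul (W * E) hD
    exact this
  obtain ⟨V, hV1, hV2, hV, -⟩ := spec_eq hM
  refine ⟨W * E * V, Vᴴ * E' * Wᴴ, hM.eigenvalues, ?_, ?_, ?_⟩
  · calc W * E * V * (Vᴴ * E' * Wᴴ) = W * (E * (V * Vᴴ) * E') * Wᴴ := by simp only [mul_assoc]
      _ = 1 := by rw [hV2, mul_one, hE, mul_one, hW2]
  · rw [hW]
    simp only [conjTranspose_mul, hEE]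
    calc Vᴴ * (E * Wᴴ) * (W * diagonal (fun i => (lam i : ℂ)) * Wᴴ) * (W * E * V)
        = Vᴴ * (E * (Wᴴ * W) * diagonal (fun i => (lam i : ℂ)) * (Wᴴ * W) * E) * V := by
          simp only [mul_assoc]
      _ = 1 := by rw [hW1, mul_one, mul_one, hElE, mul_one, hV1]
  · calc (W * E * V)ᴴ * D * (W * E * V) = Vᴴ * ((W * E)ᴴ * D * (W * E)) * V := by
          rw [conjTranspose_mul]; simp only [mul_assoc]
      _ = (Vᴴ * V) * diagonal (fun i => (hM.eigenvalues i : ℂ)) * (Vᴴ * V) := by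
          conv_lhs => rw [hV]
          simp only [mul_assoc]
      _ = _ := by rw [hV1]; simp

theorem det_shift {d : ℕ} {A : Matrix (Fin d) (Fin d) ℂ} (hA : A.IsHermitian) (x : ℝ) :
    (A + (x : ℂ) • 1).det = ((∏ i, (hA.eigenvalues i + x) : ℝ) : ℂ) := by
  obtain ⟨W, hW1, hW2, hW, -⟩ := spec_eq hA
  have hx : A + (x : ℂ) • 1 = W * diagonal (fun i => ((hA.eigenvalues i + x : ℝ) : ℂ)) * Wᴴ := by
    have : diagonal (fun i => ((hA.eigenvalues i + x : ℝ) : ℂ)) =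
        diagonal (fun i => ((hA.eigenvalues i : ℝ) : ℂ)) + (x : ℂ) • 1 := by
      ext i j; by_cases hij : i = j <;> simp [hij]
    rw [this, mul_add, add_mul, ← hW]
    simp [hW2]
  rw [hx, det_mul, det_mul, mul_right_comm, ← det_mul, hW2, det_one, one_mul, det_diagonal]
  push_cast; rfl

theorem vN_eq_s16 {d : ℕ} {A : Matrix (Fin d) (Fin d) ℂ} (hA : A.IsHermitian) :
    vN A = - ∑ i, hA.eigenvalues i * Real.log (hA.eigenvalues i) := by
  obtain ⟨W, hW1, hW2, hW, hL⟩ := spec_eq hA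
  have : A * matLog A = W * diagonal (fun i =>
      ((hA.eigenvalues i * Real.log (hA.eigenvalues i) : ℝ) : ℂ)) * Wᴴ := by
    rw [hL]
    nth_rw 1 [hW]
    calc _ = W * (diagonal (fun i => (hA.eigenvalues i : ℂ)) * (Wᴴ * W) *
        diagonal (fun i => (Real.log (hA.eigenvalues i) : ℂ))) * Wᴴ := by simp only [mul_assoc]
      _ = _ := by rw [hW1, mul_one, diagonal_mul_diagonal]; push_cast; rfl
  rw [vN, this, trace_mul_cycle, hW1, one_mul, trace_diagonal, ← Complex.ofReal_sum,
    Complex.ofReal_re]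

theorem trace_eq_re {d : ℕ} {A : Matrix (Fin d) (Fin d) ℂ} (hA : A.IsHermitian) :
    A.trace.re = ∑ i, hA.eigenvalues i := by
  rw [hA.trace_eq_sum_eigenvalues]; simp

noncomputable def negTr {d : ℕ} {A : Matrix (Fin d) (Fin d) ℂ} (hA : A.IsHermitian) : ℝ :=
  ∑ i, max (-hA.eigenvalues i) 0

theorem negTr_mono {d : ℕ} {Φ : Matrix (Fin d) (Fin d) ℂ →ₗ[ℂ] Matrix (Fin d) (Fin d) ℂ}
    (hΦ : IsPTP Φ) {A B : Matrix (Fin d) (Fin d) ℂ} (hA : A.IsHermitian) (hB : B.IsHermitian)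
    (hAB : Φ A = B) : negTr hB ≤ negTr hA := by
  obtain ⟨W, hW1, hW2, hW, -⟩ := spec_eq hA
  obtain ⟨V, hV1, hV2, hV, -⟩ := spec_eq hB
  set N : Matrix (Fin d) (Fin d) ℂ :=
    W * diagonal (fun i => ((max (-hA.eigenvalues i) 0 : ℝ) : ℂ)) * Wᴴ with hN
  have hNp : N.PosSemidef := by
    refine PosSemidef.mul_mul_conjTranspose_same (PosSemidef.diagonal fun i => ?_) W
    simp only [Pi.zero_apply]
    exact_mod_cast le_max_right _ _
  have hANp : (A + N).PosSemidef := by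
    have : A + N = W * diagonal (fun i =>
        ((hA.eigenvalues i + max (-hA.eigenvalues i) 0 : ℝ) : ℂ)) * Wᴴ := by
      conv_lhs => rw [hW, hN]
      rw [← add_mul, ← mul_add, diagonal_add]; push_cast; rfl
    rw [this]
    refine PosSemidef.mul_mul_conjTranspose_same (PosSemidef.diagonal fun i => ?_) W
    simp only [Pi.zero_apply]
    have : 0 ≤ hA.eigenvalues i + max (-hA.eigenvalues i) 0 := by
      linarith [le_max_left (-hA.eigenvalues i) 0]
    exact_mod_cast this
  have h1 := (hΦ.1 _ hNp).conjTranspose_mul_mul_same V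
  have h2 := (hΦ.1 _ hANp).conjTranspose_mul_mul_same V
  rw [map_add, hAB, mul_add, add_mul] at h2
  have hVB : Vᴴ * B * V = diagonal (fun i => (hB.eigenvalues i : ℂ)) := by
    calc _ = Vᴴ * (V * diagonal (fun i => (hB.eigenvalues i : ℂ)) * Vᴴ) * V := by rw [← hV]
      _ = (Vᴴ * V) * diagonal (fun i => (hB.eigenvalues i : ℂ)) * (Vᴴ * V) := by
        simp only [mul_assoc]
      _ = _ := by rw [hV1]; simp
  rw [hVB] at h2
  set K := Vᴴ * Φ N * V with hK
  have hKtr : K.trace.re = negTr hA := by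
    rw [hK, trace_mul_cycle, hV2, one_mul, hΦ.2, hN, trace_mul_cycle, hW1, one_mul, trace_diagonal,
      ← Complex.ofReal_sum, Complex.ofReal_re, negTr]
  rw [← hKtr, trace, Complex.re_sum, negTr]
  refine Finset.sum_le_sum fun i _ => ?_
  have e1 := (Complex.le_def.1 (h1.diag_nonneg (i := i))).1
  have e2 := (Complex.le_def.1 (h2.diag_nonneg (i := i))).1
  simp at e1 e2
  simp only [diag_apply]
  refine max_le ?_ e1
  linarith

theorem kint {m : ℝ} (h0 : 0 < m) (h1 : m < 1) :
    ∫⁻ t in Set.Ioi (1 / m), ENNReal.ofReal (1 / (t * (t ^ 2 - 1))) =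
      ENNReal.ofReal (-(Real.log (1 - m ^ 2) / 2)) := by
  have hm : 1 < 1 / m := by rw [lt_div_iff₀ h0]; linarith
  have hd : ∀ t ∈ Set.Ici (1 / m), HasDerivAt (fun t : ℝ => Real.log (1 - (t ^ 2)⁻¹) / 2)
      (1 / (t * (t ^ 2 - 1))) t := by
    intro t ht
    have ht1 : 1 < t := lt_of_lt_of_le hm ht
    have ht2 : 0 < t ^ 2 - 1 := by nlinarith
    have ht3 : (1 : ℝ) - (t ^ 2)⁻¹ ≠ 0 := by
      have : (1 : ℝ) - (t ^ 2)⁻¹ = (t ^ 2 - 1) / t ^ 2 := by field_simp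
      rw [this]; positivity
    have := ((((hasDerivAt_pow 2 t).inv (by positivity)).const_sub 1).log ht3).div_const 2
    refine this.congr_deriv ?_
    have e1 : t ^ 2 - 1 ≠ 0 := ht2.ne'
    have e2 : (t ^ 2 - 1) / t ^ 2 = (1 : ℝ) - (t ^ 2)⁻¹ := by field_simp
    have e3 : (fun x : ℝ => x ^ 2)⁻¹ t = (t ^ 2)⁻¹ := rfl
    rw [e3, ← e2]
    push_cast
    field_simp
  have hp : ∀ t ∈ Set.Ioi (1 / m), 0 ≤ 1 / (t * (t ^ 2 - 1)) := by
    intro t ht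
    have ht1 : 1 < t := lt_trans hm ht
    have ht2 : 0 < t ^ 2 - 1 := by nlinarith
    positivity
  have hl : Tendsto (fun t : ℝ => Real.log (1 - (t ^ 2)⁻¹) / 2) atTop (𝓝 0) := by
    have h2 : Tendsto (fun t : ℝ => 1 - (t ^ 2)⁻¹) atTop (𝓝 (1 - 0)) :=
      (tendsto_inv_atTop_zero.comp (tendsto_pow_atTop two_ne_zero)).const_sub 1
    have := (h2.log (by norm_num)).div_const 2
    simpa using this
  rw [← ofReal_integral_eq_lintegral_ofReal (integrableOn_Ioi_deriv_of_nonneg' hd hp hl),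
    integral_Ioi_of_hasDerivAt_of_nonneg' hd hp hl]
  · congr 1; field_simp; simp
  · exact (ae_restrict_iff' measurableSet_Ioi).2 (ae_of_all _ hp)

theorem kint2 {μ : ℝ} (h1 : -1 < μ) (h2 : μ < 1) :
    ∫⁻ t in Set.Ioi (1 : ℝ), ENNReal.ofReal (1 / (t * (t ^ 2 - 1))) *
      ((if 1 + t * μ < 0 then 1 else 0) + (if 1 + (-t) * μ < 0 then 1 else 0)) =
      ENNReal.ofReal (-(Real.log (1 - μ ^ 2) / 2)) := by
  rcases eq_or_ne μ 0 with rfl | hne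
  · have : ¬ ((1 : ℝ) < 0) := by norm_num
    simp [this]
  have h0 : 0 < |μ| := abs_pos.2 hne
  have hlt : |μ| < 1 := abs_lt.2 ⟨h1, h2⟩
  rw [← sq_abs, ← kint h0 hlt]
  have hm : 1 < 1 / |μ| := by rw [lt_div_iff₀ h0]; linarith
  have hset : Set.Ioi (1 / |μ|) = Set.Ioi (1 / |μ|) ∩ Set.Ioi 1 := by
    ext t; simp only [Set.mem_inter_iff, Set.mem_Ioi]; exact ⟨fun h => ⟨h, hm.trans h⟩, fun h => h.1⟩
  rw [hset, ← setLIntegral_indicator measurableSet_Ioi]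
  refine setLIntegral_congr_fun measurableSet_Ioi fun t ht => ?_
  have ht : 1 < t := ht
  simp only [Set.indicator_apply, Set.mem_Ioi, div_lt_iff₀ h0]
  rcases lt_or_gt_of_ne hne with h | h
  · rw [abs_of_neg h]
    have e1 : ¬ (1 + (-t) * μ < 0) := by nlinarith
    by_cases e : 1 + t * μ < 0
    · rw [if_pos e, if_neg e1, if_pos (by linarith)]; simp
    · rw [if_neg e, if_neg e1, if_neg (by linarith)]; simp
  · rw [abs_of_pos h]
    have e1 : ¬ (1 + t * μ < 0) := by nlinarith
    by_cases e : 1 + (-t) * μ < 0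
    · rw [if_pos e, if_neg e1, if_pos (by linarith)]; simp
    · rw [if_neg e, if_neg e1, if_neg (by linarith)]; simp

theorem eta_tendsto {l : ℝ} (hl : 0 ≤ l) :
    Tendsto (fun x : ℝ => (l + x) * Real.log (l + x) - (l + x) * Real.log x) atTop (𝓝 l) := by
  have h1 := Real.tendsto_mul_log_one_add_div_atTop l
  have h2 : Tendsto (fun x : ℝ => l * Real.log (1 + l / x)) atTop (𝓝 (l * Real.log (1 + 0))) :=
    (((tendsto_const_nhds.div_atTop tendsto_id).const_add 1).log (by norm_num)).const_mul l
  have h3 := h2.add h1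
  simp only [add_zero, Real.log_one, mul_zero, zero_add] at h3
  refine h3.congr' ?_
  filter_upwards [eventually_gt_atTop 0] with x hx
  have : 1 + l / x = (l + x) / x := by field_simp; ring
  rw [this, Real.log_div (by positivity) hx.ne']
  ring

theorem gint {d : ℕ} {s a b : Fin d → ℝ} (hs : ∀ i, 0 ≤ s i) (ha : ∀ i, 0 ≤ a i)
    (hb : ∀ i, 0 ≤ b i) (htr : 2 * ∑ i, s i = ∑ i, a i + ∑ i, b i)
    (hG : ∀ x : ℝ, 0 < x → 0 ≤ ∑ i, (2 * Real.log (s i + x) - Real.log (a i + x)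
      - Real.log (b i + x))) :
    0 ≤ ∑ i, (a i * Real.log (a i) + b i * Real.log (b i) - 2 * (s i * Real.log (s i))) ∧
    ∫⁻ x in Set.Ioi (0 : ℝ), ENNReal.ofReal (∑ i, (2 * Real.log (s i + x) - Real.log (a i + x)
      - Real.log (b i + x))) = ENNReal.ofReal
      (∑ i, (a i * Real.log (a i) + b i * Real.log (b i) - 2 * (s i * Real.log (s i)))) := by
  let g : ℝ → ℝ := fun x => ∑ i, (2 * ((s i + x) * Real.log (s i + x))
    - (a i + x) * Real.log (a i + x) - (b i + x) * Real.log (b i + x))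
  have hc : Continuous g := by
    have h := Real.continuous_mul_log
    refine continuous_finsetSum _ fun i _ => ?_
    have e : ∀ c : ℝ, Continuous fun x : ℝ => (c + x) * Real.log (c + x) := fun c =>
      h.comp (continuous_const.add continuous_id)
    exact (((e _).const_mul 2).sub (e _)).sub (e _)
  have hd : ∀ x ∈ Set.Ioi (0 : ℝ), HasDerivAt g (∑ i, (2 * Real.log (s i + x) - Real.log (a i + x)
      - Real.log (b i + x))) x := by
    intro x hx
    have hx : 0 < x := hx
    have e : ∀ c : ℝ, 0 ≤ c → HasDerivAt (fun x : ℝ => (c + x) * Real.log (c + x))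
        (Real.log (c + x) + 1) x := fun c hc => by
      have := (Real.hasDerivAt_mul_log (x := c + x) (by positivity)).comp x
        ((hasDerivAt_id x).const_add c)
      exact this.congr_deriv (by simp)
    refine HasDerivAt.fun_sum fun i _ => ?_
    exact ((((e _ (hs i)).const_mul 2).sub (e _ (ha i))).sub (e _ (hb i))).congr_deriv (by ring)
  have hl : Tendsto g atTop (𝓝 0) := by
    have h := tendsto_finsetSum (Finset.univ : Finset (Fin d)) fun i _ =>
      (((eta_tendsto (hs i)).const_mul 2).sub (eta_tendsto (ha i))).sub (eta_tendsto (hb i))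
    have e : ∑ i, (2 * s i - a i - b i) = 0 := by
      simp only [Finset.sum_sub_distrib, ← Finset.mul_sum]; linarith
    rw [e] at h
    refine h.congr fun x => ?_
    have : ∑ i, ((2 * s i - a i - b i) * Real.log x) = 0 := by rw [← Finset.sum_mul, e, zero_mul]
    rw [← sub_eq_zero, ← Finset.sum_sub_distrib, ← neg_eq_zero, ← Finset.sum_neg_distrib, ← this]
    refine Finset.sum_congr rfl fun i _ => ?_
    ring
  have hi := integrableOn_Ioi_deriv_of_nonneg hc.continuousWithinAt hd (fun x hx => hG x hx) hl
  have hI := integral_Ioi_of_hasDerivAt_of_nonneg hc.continuousWithinAt hd (fun x hx => hG x hx) hl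
  have hae := (ae_restrict_iff' (μ := volume) measurableSet_Ioi).2
    (ae_of_all _ (fun x (hx : x ∈ Set.Ioi (0 : ℝ)) => hG x hx))
  have hJ : (0 - g 0) =
      ∑ i, (a i * Real.log (a i) + b i * Real.log (b i) - 2 * (s i * Real.log (s i))) := by
    simp only [g, add_zero]
    rw [zero_sub, ← Finset.sum_neg_distrib]
    refine Finset.sum_congr rfl fun i _ => ?_
    ring
  rw [← hJ, ← hI]
  exact ⟨integral_nonneg_of_ae hae, (ofReal_integral_eq_lintegral_ofReal hi hae).symm⟩

noncomputable def cN {d : ℕ} (v : Fin d → ℝ) : ℕ := Fintype.card {i // v i < 0}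

theorem cN_eq {d : ℕ} (v : Fin d → ℝ) : cN v = ∑ i, if v i < 0 then 1 else 0 := by
  rw [cN, Fintype.card_subtype, Finset.card_filter]

theorem cN_coe {d : ℕ} (v : Fin d → ℝ) :
    ((cN v : ℕ) : ENNReal) = ∑ i, if v i < 0 then 1 else 0 := by
  rw [cN_eq]; push_cast; rfl

theorem cN_mono {d : ℕ} {v w : Fin d → ℝ} (h : ∀ i, v i < 0 → w i < 0) : cN v ≤ cN w :=
  Fintype.card_subtype_mono _ _ h

theorem layer {d : ℕ} (v : Fin d → ℝ) :
    ∫⁻ x in Set.Ioi (0 : ℝ), (cN (fun i => v i + x) : ENNReal) =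
      ENNReal.ofReal (∑ i, max (-v i) 0) := by
  simp only [cN_coe]
  have hm : ∀ c : ℝ, MeasurableSet {x : ℝ | c + x < 0} := fun c =>
    measurableSet_lt (by fun_prop) (by fun_prop)
  rw [lintegral_finsetSum _ fun i _ => Measurable.ite (hm _) (by fun_prop) (by fun_prop),
    ENNReal.ofReal_sum_of_nonneg fun i _ => le_max_right _ _]
  refine Finset.sum_congr rfl fun i _ => ?_
  have : (fun x : ℝ => if v i + x < 0 then (1 : ENNReal) else 0) =
      Set.indicator {x : ℝ | v i + x < 0} 1 := by
    ext x; simp [Set.indicator_apply]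
  rw [this, lintegral_indicator_one (hm _), Measure.restrict_apply (hm _)]
  have : {x : ℝ | v i + x < 0} ∩ Set.Ioi 0 = Set.Ioo 0 (-v i) := by
    ext x; simp only [Set.mem_inter_iff, Set.mem_ofPred_eq, Set.mem_Ioi, Set.mem_Ioo]
    constructor <;> rintro ⟨h1, h2⟩ <;> constructor <;> linarith
  rw [this, Real.volume_Ioo, sub_zero]
  rcases le_total (-v i) 0 with h | h
  · rw [max_eq_right h, ENNReal.ofReal_of_nonpos h, ENNReal.ofReal_zero]
  · rw [max_eq_left h]

theorem meas_count {d : ℕ} {lam : ℝ → Fin d → ℝ} {μ : ℝ → Fin d → ℝ}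
    (h : ∀ x, 0 < x → ∀ t, cN (fun i => lam t i + x) = cN (fun i => 1 + t * μ x i)) (c : ℝ) :
    AEMeasurable (fun p : ℝ × ℝ => (cN (fun i => lam (c * p.1) i + p.2) : ENNReal))
      ((volume.restrict (Set.Ioi 1)).prod (volume.restrict (Set.Ioi 0))) := by
  let f : ℝ × ℝ → ℕ := fun p => if 0 < p.2 then cN (fun i => lam (c * p.1) i + p.2) else 0
  have hf : Measurable f := by
    refine measurable_of_Ioi fun k => ?_
    have hset : f ⁻¹' Set.Ioi k = ⋃ q : ℚ, ({t : ℝ | (0 : ℝ) < q ∧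
        k < cN (fun i => lam (c * t) i + q)} ×ˢ Set.Ioo (0 : ℝ) q) := by
      ext ⟨t, x⟩
      simp only [Set.mem_preimage, Set.mem_Ioi, Set.mem_iUnion, Set.mem_prod, Set.mem_ofPred_eq,
        Set.mem_Ioo, f]
      constructor
      · intro hk
        by_cases hx : 0 < x
        · rw [if_pos hx] at hk
          have ev : ∀ᶠ q in 𝓝 x, ∀ i, lam (c * t) i + x < 0 → lam (c * t) i + q < 0 := by
            rw [eventually_all]
            intro i
            by_cases hi : lam (c * t) i + x < 0
            · have : Tendsto (fun q : ℝ => lam (c * t) i + q) (𝓝 x) (𝓝 (lam (c * t) i + x)) :=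
                (continuous_const.add continuous_id).tendsto x
              filter_upwards [this.eventually_lt_const hi] with q hq _ using hq
            · simp [hi]
          obtain ⟨ε, hε, hball⟩ := Metric.eventually_nhds_iff.1 ev
          obtain ⟨q, hq1, hq2⟩ := exists_rat_btwn (show x < x + ε by linarith)
          refine ⟨q, ⟨hx.trans hq1, hk.trans_le (cN_mono (hball ?_))⟩, hx, hq1⟩
          rw [Real.dist_eq, abs_of_pos] <;> linarith
        · rw [if_neg hx] at hk; omega
      · rintro ⟨q, ⟨hq, hk⟩, hx, hxq⟩
        rw [if_pos hx]
        exact hk.trans_le (cN_mono fun i hi => by linarith)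
    rw [hset]
    refine MeasurableSet.iUnion fun q => MeasurableSet.prod ?_ measurableSet_Ioo
    by_cases hq : (0 : ℝ) < q
    · simp only [hq, true_and, h q hq]
      refine measurableSet_lt measurable_const ?_
      simp only [cN_eq]
      refine Finset.measurable_fun_sum _ fun i _ => Measurable.ite ?_ (by fun_prop) (by fun_prop)
      exact measurableSet_lt (by fun_prop) (by fun_prop)
    · simp [hq]
  refine ⟨fun p => (f p : ENNReal), (measurable_from_top (f := fun n : ℕ => (n : ENNReal))).comp hf, ?_⟩
  rw [Measure.prod_restrict]
  refine (ae_restrict_iff' (measurableSet_Ioi.prod measurableSet_Ioi)).2 (ae_of_all _ fun p hp => ?_)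
  have : 0 < p.2 := hp.2
  simp [f, this]

theorem posDef_shift {d : ℕ} {A : Matrix (Fin d) (Fin d) ℂ} (hA : A.PosSemidef) {x : ℝ}
    (hx : 0 < x) : (A + (x : ℂ) • 1).PosDef := by
  refine PosDef.posSemidef_add hA ?_
  exact PosDef.one.smul (by exact_mod_cast hx)

theorem log_det_aux {d : ℕ} {A P : Matrix (Fin d) (Fin d) ℂ} (hA : A.PosSemidef) {x : ℝ}
    (hx : 0 < x) {ν : Fin d → ℝ} (hP : P.det ≠ 0)
    (h : Pᴴ * (A + (x : ℂ) • 1) * P = diagonal (fun i => (ν i : ℂ))) :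
    (∀ i, 0 < ν i) ∧
    Real.log (Complex.normSq P.det) + ∑ i, Real.log (hA.1.eigenvalues i + x) =
      ∑ i, Real.log (ν i) := by
  have hν : ∀ i, 0 < ν i := by
    intro i
    have h1 : (Pᴴ * (A + (x : ℂ) • 1) * P).PosDef := by
      refine (posDef_shift hA hx).conjTranspose_mul_mul_same ?_
      exact Matrix.mulVec_injective_of_isUnit ((Matrix.isUnit_iff_isUnit_det _).2 hP.isUnit)
    rw [h] at h1
    have := h1.diag_pos (i := i)
    rw [diagonal_apply_eq] at this
    exact_mod_cast this
  refine ⟨hν, ?_⟩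
  have h2 := congrArg Matrix.det h
  rw [det_mul, det_mul, det_shift hA.1, det_diagonal, det_conjTranspose, mul_right_comm] at h2
  have h3 : star P.det * P.det = (Complex.normSq P.det : ℂ) := by
    rw [Complex.normSq_eq_conj_mul_self]; rfl
  rw [h3] at h2
  have h4 : Complex.normSq P.det * ∏ i, (hA.1.eigenvalues i + x) = ∏ i, ν i := by
    exact_mod_cast h2
  have h5 : ∀ i, 0 < hA.1.eigenvalues i + x := fun i => by
    have := hA.eigenvalues_nonneg i; linarith
  rw [← Real.log_prod (fun i _ => (h5 i).ne'), ← Real.log_prod (fun i _ => (hν i).ne'), ← h4,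
    Real.log_mul]
  · simpa using hP
  · exact (Finset.prod_pos fun i _ => h5 i).ne'

theorem js_formula {d : ℕ} {A D : Matrix (Fin d) (Fin d) ℂ} (hA : A.PosSemidef)
    (hp : (A + D).PosSemidef) (hm : (A - D).PosSemidef)
    (hL : ∀ t : ℝ, (A + (t : ℂ) • D).IsHermitian) :
    0 ≤ 2 * vN A - vN (A + D) - vN (A - D) ∧
    ENNReal.ofReal (2 * vN A - vN (A + D) - vN (A - D)) =
      ∫⁻ t in Set.Ioi (1 : ℝ), 2 * (ENNReal.ofReal (1 / (t * (t ^ 2 - 1))) *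
        (ENNReal.ofReal (negTr (hL t)) + ENNReal.ofReal (negTr (hL (-t))))) := by
  have hD : D.IsHermitian := by
    have : D = (A + D) - A := by abel
    rw [this]; exact hp.1.sub hA.1
  have hex : ∀ x : ℝ, ∃ μ : Fin d → ℝ, 0 < x →
      (∀ t, cN (fun i => (hL t).eigenvalues i + x) = cN (fun i => 1 + t * μ i)) ∧
      (∀ i, -1 < μ i ∧ μ i < 1) ∧
      ∑ i, (2 * Real.log (hA.1.eigenvalues i + x) - Real.log (hp.1.eigenvalues i + x)
        - Real.log (hm.1.eigenvalues i + x)) = ∑ i, 2 * -(Real.log (1 - μ i ^ 2) / 2) := by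
    intro x
    by_cases hx : 0 < x
    swap
    · exact ⟨0, fun h => absurd h hx⟩
    obtain ⟨P, R, μ, hPR, h1, h2⟩ := simul_diag (posDef_shift hA hx) hD
    have hdet : P.det ≠ 0 := by
      intro h0
      have := congrArg Matrix.det hPR
      rw [det_mul, h0, zero_mul, det_one] at this
      exact zero_ne_one this
    have hdiag : ∀ t : ℝ, Pᴴ * (A + (t : ℂ) • D + (x : ℂ) • 1) * P =
        diagonal (fun i => ((1 + t * μ i : ℝ) : ℂ)) := by
      intro t
      have e : A + (t : ℂ) • D + (x : ℂ) • 1 = (A + (x : ℂ) • 1) + (t : ℂ) • D := by abel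
      rw [e, mul_add, add_mul, h1, mul_smul_comm, smul_mul_assoc, h2]
      ext i j; by_cases hij : i = j <;> simp [hij]
    have d0 := hdiag 0
    have d1 := hdiag 1
    have d2 := hdiag (-1)
    simp only [Complex.ofReal_zero, zero_smul, add_zero, zero_mul] at d0
    simp only [Complex.ofReal_one, one_smul, one_mul] at d1
    simp only [Complex.ofReal_neg, Complex.ofReal_one, neg_smul, one_smul, neg_mul, one_mul,
      ← sub_eq_add_neg] at d2
    obtain ⟨-, l0⟩ := log_det_aux hA hx (ν := fun _ => 1) hdet d0
    obtain ⟨p1, l1⟩ := log_det_aux hp hx (ν := fun i => 1 + μ i) hdet d1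
    obtain ⟨p2, l2⟩ := log_det_aux hm hx (ν := fun i => 1 - μ i) hdet d2
    refine ⟨μ, fun _ => ⟨fun t => ?_, fun i => ⟨?_, ?_⟩, ?_⟩⟩
    · exact (inertia_eq (hL t) x hPR (hdiag t)).symm
    · linarith [p1 i]
    · linarith [p2 i]
    · have e : ∀ i, 2 * -(Real.log (1 - μ i ^ 2) / 2) =
          - Real.log (1 + μ i) - Real.log (1 - μ i) := by
        intro i
        have : 1 - μ i ^ 2 = (1 + μ i) * (1 - μ i) := by ring
        rw [this, Real.log_mul (p1 i).ne' (p2 i).ne']; ring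
      simp only [e, Finset.sum_sub_distrib, ← Finset.mul_sum, Finset.sum_neg_distrib]
      simp only [Real.log_one, Finset.sum_const_zero] at l0
      linarith
  choose μ hμ using hex
  have htr : 2 * ∑ i, hA.1.eigenvalues i =
      ∑ i, hp.1.eigenvalues i + ∑ i, hm.1.eigenvalues i := by
    rw [← trace_eq_re, ← trace_eq_re, ← trace_eq_re, trace_add, trace_sub]
    simp; ring
  have hpos : ∀ x : ℝ, 0 < x → ∀ i, 0 ≤ -(Real.log (1 - μ x i ^ 2) / 2) := by
    intro x hx i
    have h1 := ((hμ x hx).2.1 i).1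
    have h2 := ((hμ x hx).2.1 i).2
    have := Real.log_nonpos (x := 1 - μ x i ^ 2) (by nlinarith) (by nlinarith)
    linarith
  have hG : ∀ x : ℝ, 0 < x → 0 ≤ ∑ i, (2 * Real.log (hA.1.eigenvalues i + x)
      - Real.log (hp.1.eigenvalues i + x) - Real.log (hm.1.eigenvalues i + x)) := by
    intro x hx
    rw [(hμ x hx).2.2]
    exact Finset.sum_nonneg fun i _ => by have := hpos x hx i; linarith
  obtain ⟨g1, g2⟩ := gint hA.eigenvalues_nonneg hp.eigenvalues_nonneg hm.eigenvalues_nonneg htr hG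
  have hJ : 2 * vN A - vN (A + D) - vN (A - D) =
      ∑ i, (hp.1.eigenvalues i * Real.log (hp.1.eigenvalues i)
        + hm.1.eigenvalues i * Real.log (hm.1.eigenvalues i)
        - 2 * (hA.1.eigenvalues i * Real.log (hA.1.eigenvalues i))) := by
    rw [vN_eq_s16 hA.1, vN_eq_s16 hp.1, vN_eq_s16 hm.1]
    simp only [Finset.sum_sub_distrib, Finset.sum_add_distrib, ← Finset.mul_sum]
    ring
  rw [hJ]
  refine ⟨g1, ?_⟩
  rw [← g2]
  have hcount := fun x hx => (hμ x hx).1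
  have hkm : Measurable fun t : ℝ => ENNReal.ofReal (1 / (t * (t ^ 2 - 1))) := by fun_prop
  have m1 := meas_count (lam := fun t => (hL t).eigenvalues) hcount 1
  have m2 := meas_count (lam := fun t => (hL t).eigenvalues) hcount (-1)
  simp only [one_mul, neg_mul] at m1 m2
  have step1 : ∀ x ∈ Set.Ioi (0 : ℝ), ENNReal.ofReal (∑ i, (2 * Real.log (hA.1.eigenvalues i + x)
      - Real.log (hp.1.eigenvalues i + x) - Real.log (hm.1.eigenvalues i + x))) =
      ∫⁻ t in Set.Ioi (1 : ℝ), 2 * (ENNReal.ofReal (1 / (t * (t ^ 2 - 1))) *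
        ((cN (fun i => (hL t).eigenvalues i + x) : ENNReal)
          + (cN (fun i => (hL (-t)).eigenvalues i + x) : ENNReal))) := by
    intro x hx
    have hx : 0 < x := hx
    rw [(hμ x hx).2.2]
    simp only [hcount x hx, cN_coe, ← Finset.sum_add_distrib, Finset.mul_sum]
    have hmm : ∀ c : ℝ, MeasurableSet {t : ℝ | 1 + t * c < 0} := fun c =>
      measurableSet_lt (by fun_prop) (by fun_prop)
    have hmm' : ∀ c : ℝ, MeasurableSet {t : ℝ | 1 + (-t) * c < 0} := fun c =>
      measurableSet_lt (by fun_prop) (by fun_prop)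
    have hF : ∀ i, Measurable fun t : ℝ => ENNReal.ofReal (1 / (t * (t ^ 2 - 1))) *
        (((if 1 + t * μ x i < 0 then 1 else 0) + (if 1 + (-t) * μ x i < 0 then 1 else 0) :
          ENNReal)) := fun i =>
      hkm.mul ((Measurable.ite (hmm _) (by fun_prop) (by fun_prop)).add
        (Measurable.ite (hmm' _) (by fun_prop) (by fun_prop)))
    rw [lintegral_finsetSum _ fun i _ => (hF i).const_mul 2,
      ENNReal.ofReal_sum_of_nonneg fun i _ => by have := hpos x hx i; linarith]
    refine Finset.sum_congr rfl fun i _ => ?_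
    rw [lintegral_const_mul _ (hF i), kint2 ((hμ x hx).2.1 i).1 ((hμ x hx).2.1 i).2,
      ENNReal.ofReal_mul (by norm_num)]
    simp
  rw [setLIntegral_congr_fun measurableSet_Ioi step1, ← lintegral_lintegral_swap]
  · refine lintegral_congr fun t => ?_
    have n1 : AEMeasurable (fun x : ℝ => (cN (fun i => (hL t).eigenvalues i + x) : ENNReal))
        (volume.restrict (Set.Ioi 0)) := by
      refine Measurable.aemeasurable ?_
      simp only [cN_coe]
      refine Finset.measurable_fun_sum _ fun i _ => Measurable.ite ?_ (by fun_prop) (by fun_prop)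
      exact measurableSet_lt (by fun_prop) (by fun_prop)
    rw [lintegral_const_mul' _ _ (by norm_num), lintegral_const_mul' _ _ ENNReal.ofReal_ne_top,
      lintegral_add_left' n1, layer, layer]
    rfl
  · exact ((hkm.comp measurable_fst).aemeasurable.mul (m1.add m2)).const_mul 2

theorem js_mono {d : ℕ} {Φ : Matrix (Fin d) (Fin d) ℂ →ₗ[ℂ] Matrix (Fin d) (Fin d) ℂ}
    (hΦ : IsPTP Φ) {A D : Matrix (Fin d) (Fin d) ℂ} (hA : A.PosSemidef)
    (hp : (A + D).PosSemidef) (hm : (A - D).PosSemidef) :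
    2 * vN (Φ A) - vN (Φ (A + D)) - vN (Φ (A - D)) ≤
      2 * vN A - vN (A + D) - vN (A - D) := by
  have herm : ∀ {A D : Matrix (Fin d) (Fin d) ℂ}, A.PosSemidef → (A + D).PosSemidef →
      ∀ t : ℝ, (A + (t : ℂ) • D).IsHermitian := by
    intro A D hA hp t
    have hD : D.IsHermitian := by
      have : D = (A + D) - A := by abel
      rw [this]; exact hp.1.sub hA.1
    refine hA.1.add ?_
    rw [IsHermitian, conjTranspose_smul, hD.eq]; simp
  have hA' := hΦ.1 _ hA
  have hp' := hΦ.1 _ hp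
  have hm' := hΦ.1 _ hm
  rw [map_add] at hp' ⊢
  rw [map_sub] at hm' ⊢
  obtain ⟨h0, h1⟩ := js_formula hA hp hm (herm hA hp)
  obtain ⟨-, h2⟩ := js_formula hA' hp' hm' (herm hA' hp')
  rw [← ENNReal.ofReal_le_ofReal_iff h0, h1, h2]
  refine lintegral_mono fun t => ?_
  have e : ∀ t : ℝ, negTr (herm hA' hp' t) ≤ negTr (herm hA hp t) :=
    fun t => negTr_mono hΦ _ _ (by simp)
  gcongr <;> exact e _

theorem vN_conj {d : ℕ} {A U : Matrix (Fin d) (Fin d) ℂ} (hA : A.IsHermitian)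
    (h2 : Uᴴ * U = 1) : vN (U * A * Uᴴ) = vN A := by
  have hB : (U * A * Uᴴ).IsHermitian := isHermitian_mul_mul_conjTranspose U hA
  have : hB.eigenvalues = hA.eigenvalues := by
    rw [IsHermitian.eigenvalues_eq_eigenvalues_iff]
    rw [charpoly_mul_comm, ← mul_assoc, h2, one_mul]
  rw [vN_eq_s16 hB, vN_eq_s16 hA, this]

theorem matLog_comm {d : ℕ} {A U : Matrix (Fin d) (Fin d) ℂ} (hA : A.IsHermitian)
    (h : Commute A U) : Commute (matLog A) U := by
  have : matLog A = cfc Real.log A := by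
    rw [hA.cfc_eq, matLog, dif_pos hA, IsHermitian.cfc, Unitary.conjStarAlgAut_apply]; rfl
  rw [this]
  exact h.cfc_real _

theorem relEnt_twirl {d : ℕ} {A U : Matrix (Fin d) (Fin d) ℂ} (hA : A.IsHermitian)
    (h2 : Uᴴ * U = 1) (hUU : U * U = 1) :
    qRelEnt A ((2⁻¹ : ℂ) • (A + U * A * Uᴴ)) = vN ((2⁻¹ : ℂ) • (A + U * A * Uᴴ)) - vN A := by
  have hUs : Uᴴ = U := by
    calc Uᴴ = Uᴴ * (U * U) := by rw [hUU, mul_one]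
      _ = U := by rw [← mul_assoc, h2, one_mul]
  have hB : ((2⁻¹ : ℂ) • (A + U * A * Uᴴ)).IsHermitian := by
    have := hA.add (isHermitian_mul_mul_conjTranspose U hA)
    rw [IsHermitian, conjTranspose_smul, this.eq]; simp
  have hc : Commute ((2⁻¹ : ℂ) • (A + U * A * Uᴴ)) U := by
    refine Commute.smul_left ?_ _
    rw [hUs, commute_iff_eq, add_mul, mul_add, add_comm]
    congr 1
    · rw [mul_assoc, hUU, mul_one]
    · rw [← mul_assoc, ← mul_assoc, hUU, one_mul]
  have hL := matLog_comm hB hc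
  have key : ((2⁻¹ : ℂ) • (A + U * A * Uᴴ) * matLog ((2⁻¹ : ℂ) • (A + U * A * Uᴴ))).trace =
      (A * matLog ((2⁻¹ : ℂ) • (A + U * A * Uᴴ))).trace := by
    set B := (2⁻¹ : ℂ) • (A + U * A * Uᴴ) with hBdef
    set L := matLog B
    have e : (U * A * Uᴴ * L).trace = (A * L).trace := by
      rw [hUs, mul_assoc, ← hL.eq, ← mul_assoc, trace_mul_comm, ← mul_assoc, ← mul_assoc, hUU,
        one_mul]
    conv_lhs => rw [hBdef]
    rw [smul_mul_assoc, trace_smul, add_mul, trace_add, e, smul_eq_mul]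
    ring
  rw [qRelEnt, mul_sub, trace_sub, Complex.sub_re, ← key, vN, vN]
  ring

/-- EP of a process that is symmetric under a unitary involution `U`: the twirled state
`Ψ(ρ) = (ρ + UρU†)/2` minimizes EP among convex combinations of `ρ` and `UρU†`, and the
mismatch cost of `ρ` relative to `Ψ(ρ)` equals the drop of the relative entropy of asymmetry;
moreover `Ψ(ρ) ≥ ρ/2` and `Ψ(Φ(ρ)) = Φ(Ψ(ρ)) ≥ Φ(ρ)/2`, making the relative entropies finite. -/
theorem symmetry_mismatch_cost {d : ℕ} (hd : 1 ≤ d)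
    (Φ : Matrix (Fin d) (Fin d) ℂ →ₗ[ℂ] Matrix (Fin d) (Fin d) ℂ) (hΦ : IsPTP Φ)
    (Q : Matrix (Fin d) (Fin d) ℂ →ₗ[ℝ] ℝ)
    (U : Matrix (Fin d) (Fin d) ℂ) (hU : U ∈ Matrix.unitaryGroup (Fin d) ℂ)
    (hUinv : U * U = 1)
    (hcov : ∀ X : Matrix (Fin d) (Fin d) ℂ, Φ (U * X * Uᴴ) = U * (Φ X) * Uᴴ)
    (hQinv : ∀ σ : Matrix (Fin d) (Fin d) ℂ, IsDensity σ → Q (U * σ * Uᴴ) = Q σ)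
    (ρ : Matrix (Fin d) (Fin d) ℂ) (hρ : IsDensity ρ) :
    ∀ Ψ : Matrix (Fin d) (Fin d) ℂ → Matrix (Fin d) (Fin d) ℂ,
      (∀ X, Ψ X = (2⁻¹ : ℂ) • (X + U * X * Uᴴ)) →
      (∀ l ∈ Set.Icc (0 : ℝ) 1,
        EPfun Φ Q (Ψ ρ) ≤ EPfun Φ Q ((l : ℂ) • ρ + (1 - (l : ℂ)) • (U * ρ * Uᴴ))) ∧
      (Ψ ρ - (2⁻¹ : ℂ) • ρ).PosSemidef ∧
      Ψ (Φ ρ) = Φ (Ψ ρ) ∧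
      (Ψ (Φ ρ) - (2⁻¹ : ℂ) • (Φ ρ)).PosSemidef ∧
      EPfun Φ Q ρ - EPfun Φ Q (Ψ ρ) = qRelEnt ρ (Ψ ρ) - qRelEnt (Φ ρ) (Ψ (Φ ρ)) := by
  have hU1 : U * Uᴴ = 1 := Matrix.mem_unitaryGroup_iff.1 hU
  have hU2 : Uᴴ * U = 1 := Matrix.mem_unitaryGroup_iff'.1 hU
  have hUs : Uᴴ = U := by
    calc Uᴴ = Uᴴ * (U * U) := by rw [hUinv, mul_one]
      _ = U := by rw [← mul_assoc, hU2, one_mul]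
  intro Ψ hΨ
  have half : (0 : ℂ) ≤ 2⁻¹ := by
    rw [inv_nonneg]; norm_num
  have hconj : ∀ {σ : Matrix (Fin d) (Fin d) ℂ}, σ.PosSemidef → (U * σ * Uᴴ).PosSemidef :=
    fun h => h.mul_mul_conjTranspose_same U
  have hge : ∀ σ : Matrix (Fin d) (Fin d) ℂ, σ.PosSemidef →
      (Ψ σ - (2⁻¹ : ℂ) • σ).PosSemidef := by
    intro σ hσ
    rw [hΨ, smul_add, add_sub_cancel_left]
    exact (hconj hσ).smul half
  have hcomm : ∀ σ, Ψ (Φ σ) = Φ (Ψ σ) := by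
    intro σ
    rw [hΨ, hΨ, map_smul, map_add, hcov]
  have hQΨ : ∀ σ, IsDensity σ → Q (Ψ σ) = Q σ := by
    intro σ hσ
    have : Ψ σ = (2⁻¹ : ℝ) • (σ + U * σ * Uᴴ) := by
      rw [hΨ]; ext i j; simp; ring
    rw [this, map_smul, map_add, hQinv σ hσ, smul_eq_mul]; ring
  have hvΨ : ∀ σ : Matrix (Fin d) (Fin d) ℂ, σ.PosSemidef → qRelEnt σ (Ψ σ) = vN (Ψ σ) - vN σ := by
    intro σ hσ
    rw [hΨ]
    exact relEnt_twirl hσ.1 hU2 hUinv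
  have hmono : ∀ σ : Matrix (Fin d) (Fin d) ℂ, IsDensity σ → EPfun Φ Q (Ψ σ) ≤ EPfun Φ Q σ := by
    intro σ hσ
    have hA : (Ψ σ).PosSemidef := by
      rw [hΨ]; exact (hσ.1.add (hconj hσ.1)).smul half
    have e1 : Ψ σ + (σ - Ψ σ) = σ := by abel
    have e2 : Ψ σ - (σ - Ψ σ) = U * σ * Uᴴ := by
      rw [hΨ]; ext i j; simp; ring
    have := js_mono hΦ (A := Ψ σ) (D := σ - Ψ σ) hA (by rw [e1]; exact hσ.1)
      (by rw [e2]; exact hconj hσ.1)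
    rw [e1, e2, hcov, vN_conj hσ.1.1 hU2, vN_conj (hΦ.1 _ hσ.1).1 hU2] at this
    rw [EPfun, EPfun, hQΨ σ hσ]
    linarith
  refine ⟨?_, hge ρ hρ.1, hcomm ρ, hge _ (hΦ.1 _ hρ.1), ?_⟩
  · intro l hl
    set σ := (l : ℂ) • ρ + (1 - (l : ℂ)) • (U * ρ * Uᴴ) with hσdef
    have hl0 : (0 : ℂ) ≤ l := by exact_mod_cast hl.1
    have hl1 : (0 : ℂ) ≤ 1 - l := by
      have : (0 : ℝ) ≤ 1 - l := by linarith [hl.2]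
      exact_mod_cast this
    have hσ : IsDensity σ := by
      refine ⟨(hρ.1.smul hl0).add ((hconj hρ.1).smul hl1), ?_⟩
      rw [hσdef, trace_add, trace_smul, trace_smul, trace_mul_cycle, hU2, one_mul, hρ.2]
      simp
    have hΨσ : Ψ σ = Ψ ρ := by
      have e : U * (U * ρ * Uᴴ) * Uᴴ = ρ := by
        rw [hUs]
        calc U * (U * ρ * U) * U = (U * U) * ρ * (U * U) := by simp only [mul_assoc]
          _ = ρ := by rw [hUinv]; simp
      rw [hΨ, hΨ, hσdef, mul_add, add_mul, mul_smul_comm, mul_smul_comm, smul_mul_assoc,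
        smul_mul_assoc, e]
      module
    rw [← hΨσ]
    exact hmono σ hσ
  · rw [hvΨ ρ hρ.1, hvΨ _ (hΦ.1 _ hρ.1), EPfun, EPfun, hQΨ ρ hρ, hcomm]
    ring
end
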